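/- arXiv:1305.3445 — 9 statements merged into one kernel-verified Lean document; each statement's English description precedes it below -/
import Mathlib

section
/- Let D : I_M^L → [0,1] be a discrete copula. Then there exists an L-dimensional stochastic array A = (a_{i_1⋯i_L}) such that D(i_1/M,...,i_L/M) = (1/M) Σ_{j_1=1}^{i_1} ⋯ Σ_{j_L=1}^{i_L} a_{j_1⋯j_L} for all i_1,...,i_L ∈ {0,1,...,M} (empty sums being 0). -/
/-- `D : I_M^L → ℝ`, encoded on integer indices: `D i` stands for
`D(i 0 / M, …, i (L-1) / M)`.  `D` is a discrete copula on `I_M^L`. -/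
def IsDiscreteCopula (M L : ℕ) (D : (Fin L → ℕ) → ℝ) : Prop :=
  -- values in [0,1]
  (∀ i : Fin L → ℕ, (∀ l, i l ≤ M) → 0 ≤ D i ∧ D i ≤ 1) ∧
  -- (D1) groundedness
  (∀ i : Fin L → ℕ, (∀ l, i l ≤ M) → (∃ l, i l = 0) → D i = 0) ∧
  -- (D2) uniform margins
  (∀ l : Fin L, ∀ k : ℕ, k ≤ M →
      D (fun l' => if l' = l then k else M) = (k : ℝ) / M) ∧
  -- (D3) L-increasing: every iterated unit first difference is nonnegative
  (∀ i : Fin L → ℕ, (∀ l, 1 ≤ i l ∧ i l ≤ M) →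
      0 ≤ ∑ ε : Fin L → Bool,
        (-1 : ℝ) ^ (Finset.univ.filter fun l => ε l = true).card *
          D (fun l => if ε l then i l - 1 else i l))

/-- `A` is an `L`-dimensional stochastic array (indices `j l : Fin M`
standing for `j l + 1 ∈ {1,…,M}`). -/
def IsStochasticArray (M L : ℕ) (A : (Fin L → Fin M) → ℝ) : Prop :=
  (∀ j, 0 ≤ A j) ∧
  ∀ (l : Fin L) (k : Fin M),
    ∑ j ∈ Finset.univ.filter (fun j : Fin L → Fin M => j l = k), A j = 1

/-- `A` represents `D`:
`D(i₁/M,…,i_L/M) = (1/M) ∑_{j₁=1}^{i₁} ⋯ ∑_{j_L=1}^{i_L} a_{j₁⋯j_L}`. -/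
def Represents (M L : ℕ) (A : (Fin L → Fin M) → ℝ) (D : (Fin L → ℕ) → ℝ) : Prop :=
  ∀ i : Fin L → ℕ, (∀ l, i l ≤ M) →
    D i = (1 / M) *
      ∑ j ∈ Finset.univ.filter (fun j : Fin L → Fin M => ∀ l, (j l : ℕ) < i l), A j

open Finset in
/-- Inclusion-exclusion on a box: the iterated unit differences of `f` over the cells below `i`
add up to the iterated difference of `f` between `0` and `i`. -/
theorem sum_iterated_difference_box {M L : ℕ} (f : (Fin L → ℕ) → ℝ) (i : Fin L → ℕ)
    (hi : ∀ l, i l ≤ M) :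
    ∑ j : Fin L → Fin M with ∀ l, (j l : ℕ) < i l, ∑ ε : Fin L → Bool,
        (∏ l, if ε l then (-1 : ℝ) else 1) * f (fun l => if ε l then (j l : ℕ) else j l + 1) =
      ∑ ε : Fin L → Bool,
        (∏ l, if ε l then (-1 : ℝ) else 1) * f (fun l => if ε l then 0 else i l) := by
  have expand (x : Fin L → ℕ) (hx : ∀ l, x l ≤ M) :
      f x = ∑ p ∈ Fintype.piFinset fun _ => range (M + 1),
        f p * ∏ l, if x l = p l then (1 : ℝ) else 0 := by
    rw [sum_eq_single x]
    · simp
    · intro p _ hp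
      obtain ⟨l, hl⟩ := Function.ne_iff.mp hp
      rw [prod_eq_zero (mem_univ l) (if_neg hl.symm), mul_zero]
    · intro h
      exact absurd (Fintype.mem_piFinset.mpr fun l => mem_range.mpr (by have := hx l; omega)) h
  have telescope (m q : ℕ) (hm : m ≤ M) :
      ∑ k ∈ univ.filter (fun k : Fin M => (k : ℕ) < m), ∑ b : Bool,
        ((if b then (-1 : ℝ) else 1) *
          if (if b then (k : ℕ) else k + 1) = q then 1 else 0) =
      ∑ b : Bool, (if b then (-1 : ℝ) else 1) *
          if (if b then 0 else m) = q then 1 else 0 := by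
    have range_sum (g : ℕ → ℝ) :
        ∑ k ∈ univ.filter (fun k : Fin M => (k : ℕ) < m), g k = ∑ k ∈ range m, g k := by
      rw [sum_filter, Fin.sum_univ_eq_sum_range (fun k => if k < m then g k else 0), ← sum_filter]
      congr 1
      ext k
      simp only [mem_filter, mem_range]
      omega
    rw [range_sum fun k => ∑ b : Bool, ((if b then (-1 : ℝ) else 1) *
      if (if b then k else k + 1) = q then 1 else 0)]
    have := sum_range_sub (fun k => if k = q then (1 : ℝ) else 0) m
    simp only [Fintype.sum_bool, if_true, Bool.false_eq_true, if_false, neg_one_mul, one_mul,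
      neg_add_eq_sub]
    exact this
  have cells : (univ.filter fun j : Fin L → Fin M => ∀ l, (j l : ℕ) < i l) =
      Fintype.piFinset fun l => univ.filter fun k : Fin M => (k : ℕ) < i l := by
    ext j
    simp
  have signs : (univ : Finset (Fin L → Bool)) = Fintype.piFinset fun _ => univ :=
    Fintype.piFinset_univ.symm
  have product (p : Fin L → ℕ) :
      ∑ j : Fin L → Fin M with ∀ l, (j l : ℕ) < i l, ∑ ε : Fin L → Bool,
        ∏ l, ((if ε l then (-1 : ℝ) else 1) *
          if (if ε l then (j l : ℕ) else j l + 1) = p l then 1 else 0) =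
      ∑ ε : Fin L → Bool, ∏ l, ((if ε l then (-1 : ℝ) else 1) *
          if (if ε l then 0 else i l) = p l then 1 else 0) := by
    rw [cells, signs]
    simp_rw [← prod_univ_sum (fun _ => (univ : Finset Bool)) fun l b =>
      ((if b then (-1 : ℝ) else 1) * if (if b then 0 else i l) = p l then 1 else 0),
      ← telescope _ _ (hi _), prod_univ_sum]
  have linear (x : (Fin L → Bool) → Fin L → ℕ) (hx : ∀ ε l, x ε l ≤ M) :
      ∑ ε : Fin L → Bool, (∏ l, if ε l then (-1 : ℝ) else 1) * f (x ε) =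
      ∑ p ∈ Fintype.piFinset fun _ => range (M + 1), f p * ∑ ε : Fin L → Bool,
        ∏ l, ((if ε l then (-1 : ℝ) else 1) * if x ε l = p l then 1 else 0) := by
    simp_rw [mul_sum]
    rw [sum_comm]
    refine sum_congr rfl fun ε _ => ?_
    rw [expand (x ε) (hx ε), mul_sum]
    refine sum_congr rfl fun p _ => ?_
    rw [prod_mul_distrib, mul_left_comm]
  rw [linear _ fun ε l => by have := hi l; split_ifs <;> omega]
  simp_rw [← product, mul_sum (s := univ.filter _)]
  rw [eq_comm, sum_comm]
  refine sum_congr rfl fun j _ => ?_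
  exact (linear _ fun ε l => by have := (j l).isLt; split_ifs <;> omega).symm

/-- A grounded function on the grid is the sum of its iterated unit differences. -/
theorem sum_iterated_difference_of_grounded {M L : ℕ} (f : (Fin L → ℕ) → ℝ)
    (hf : ∀ i : Fin L → ℕ, (∀ l, i l ≤ M) → (∃ l, i l = 0) → f i = 0)
    (i : Fin L → ℕ) (hi : ∀ l, i l ≤ M) :
    ∑ j : Fin L → Fin M with ∀ l, (j l : ℕ) < i l, ∑ ε : Fin L → Bool,
        (∏ l, if ε l then (-1 : ℝ) else 1) * f (fun l => if ε l then (j l : ℕ) else j l + 1) =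
      f i := by
  rw [sum_iterated_difference_box f i hi, Finset.sum_eq_single fun _ => false]
  · simp
  · intro ε _ hε
    obtain ⟨l, hl⟩ := Function.ne_iff.mp hε
    rw [hf, mul_zero]
    · intro l'
      have := hi l'
      split_ifs <;> omega
    · exact ⟨l, if_pos (by simpa using hl)⟩
  · simp

/-- An array representing a function with uniform margins has slices of total mass `1`. -/
theorem Represents.sum_slice_eq_one {M L : ℕ} {A : (Fin L → Fin M) → ℝ} {D : (Fin L → ℕ) → ℝ}
    (hA : Represents M L A D)
    (hD : ∀ l : Fin L, ∀ k : ℕ, k ≤ M → D (fun l' => if l' = l then k else M) = (k : ℝ) / M)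
    (l : Fin L) (k : Fin M) :
    ∑ j ∈ Finset.univ.filter (fun j : Fin L → Fin M => j l = k), A j = 1 := by
  have hM : (M : ℝ) ≠ 0 := Nat.cast_ne_zero.mpr (Nat.ne_of_gt k.pos)
  have below (m : ℕ) (hm : m ≤ M) :
      ∑ j : Fin L → Fin M with (j l : ℕ) < m, A j = m := by
    have h := hA (fun l' => if l' = l then m else M) fun l' => by split_ifs <;> omega
    have cells : (Finset.univ.filter fun j : Fin L → Fin M =>
        ∀ l', (j l' : ℕ) < if l' = l then m else M) =
        Finset.univ.filter fun j => (j l : ℕ) < m := by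
      ext j
      simp only [Finset.mem_filter, Finset.mem_univ, true_and]
      refine ⟨fun hj => by simpa using hj l, fun hj l' => ?_⟩
      split_ifs with hl
      · exact hl ▸ hj
      · exact (j l').isLt
    rw [hD l m hm, cells] at h
    field_simp at h
    exact h.symm
  have split : (Finset.univ.filter fun j : Fin L → Fin M => (j l : ℕ) < k + 1) =
      (Finset.univ.filter fun j => (j l : ℕ) < k) ∪ Finset.univ.filter fun j => j l = k := by
    ext j
    simp only [Finset.mem_filter, Finset.mem_univ, true_and, Finset.mem_union, Fin.ext_iff]
    omega
  have disjoint : Disjoint (Finset.univ.filter fun j : Fin L → Fin M => (j l : ℕ) < k)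
      (Finset.univ.filter fun j => j l = k) := by
    refine Finset.disjoint_filter.mpr fun j _ hj => ?_
    rintro rfl
    exact lt_irrefl _ hj
  have h := below (k + 1) k.isLt
  rw [split, Finset.sum_union disjoint, below k k.isLt.le] at h
  push_cast at h
  linarith

/-- every discrete copula is represented by a stochastic array. -/
theorem discreteCopula_exists_stochasticArray (M L : ℕ) (hM : 1 ≤ M) (hL : 1 ≤ L)
    (D : (Fin L → ℕ) → ℝ) (hD : IsDiscreteCopula M L D) :
    ∃ A : (Fin L → Fin M) → ℝ, IsStochasticArray M L A ∧ Represents M L A D := by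
  obtain ⟨-, grounded, margins, increasing⟩ := hD
  have hM0 : (M : ℝ) ≠ 0 := Nat.cast_ne_zero.mpr (Nat.ne_of_gt hM)
  set A : (Fin L → Fin M) → ℝ := fun j => M * ∑ ε : Fin L → Bool,
    (∏ l, if ε l then (-1 : ℝ) else 1) * D (fun l => if ε l then (j l : ℕ) else j l + 1)
  have hA : Represents M L A D := by
    intro i hi
    rw [← Finset.mul_sum, sum_iterated_difference_of_grounded D grounded i hi]
    field_simp
  refine ⟨A, ⟨fun j => mul_nonneg M.cast_nonneg ?_, hA.sum_slice_eq_one margins⟩, hA⟩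
  simpa [Finset.prod_ite] using
    increasing (fun l => j l + 1) fun l => ⟨Nat.le_add_left 1 _, (j l).isLt⟩
end

section
/- Let D : I_M^L → [0,1] be an irreducible discrete copula. Then there exists an L-dimensional permutation array A = (a_{i_1⋯i_L}) such that D(i_1/M,...,i_L/M) = (1/M) Σ_{j_1=1}^{i_1} ⋯ Σ_{j_L=1}^{i_L} a_{j_1⋯j_L} for all i_1,...,i_L ∈ {0,1,...,M} (empty sums being 0). -/
/-- `D` is irreducible: its range (over valid index vectors) equals `I_M`. -/
def IsIrreducibleOn (M L : ℕ) (D : (Fin L → ℕ) → ℝ) : Prop :=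
  {y : ℝ | ∃ i : Fin L → ℕ, (∀ l, i l ≤ M) ∧ D i = y} =
    {y : ℝ | ∃ k : ℕ, k ≤ M ∧ y = (k : ℝ) / M}

/-- `A` is an `L`-dimensional permutation array. -/
def IsPermutationArray (M L : ℕ) (A : (Fin L → Fin M) → ℝ) : Prop :=
  IsStochasticArray M L A ∧ ∀ j, A j = 0 ∨ A j = 1

/-- The iterated unit first difference of `D` over the cell with upper corner `i`. -/
def cellDifference {L : ℕ} (D : (Fin L → ℕ) → ℝ) (i : Fin L → ℕ) : ℝ :=
  ∑ ε : Fin L → Bool, (-1 : ℝ) ^ (Finset.univ.filter fun l => ε l = true).card *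
    D (fun l => if ε l then i l - 1 else i l)

theorem eq_sum_mul_prod_indicator {M L : ℕ} (D : (Fin L → ℕ) → ℝ) (x : Fin L → ℕ)
    (hx : ∀ l, x l ≤ M) :
    D x = ∑ y : Fin L → Fin (M + 1), D (fun l => (y l : ℕ)) *
      ∏ l, (if x l = (y l : ℕ) then (1 : ℝ) else 0) := by
  rw [Finset.sum_eq_single (fun l => (⟨x l, Nat.lt_succ_of_le (hx l)⟩ : Fin (M + 1)))]
  · simp
  · intro y _ hy
    obtain ⟨l, hl⟩ := Function.ne_iff.mp hy
    rw [Finset.prod_eq_zero (Finset.mem_univ l), mul_zero]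
    rw [if_neg]
    intro h
    exact hl (Fin.ext h.symm)
  · simp

theorem cellDifference_eq_sum_mul_prod {M L : ℕ} (D : (Fin L → ℕ) → ℝ) (j : Fin L → Fin M) :
    cellDifference D (fun l => (j l : ℕ) + 1) =
      ∑ y : Fin L → Fin (M + 1), D (fun l => (y l : ℕ)) *
        ∏ l, ((if (j l : ℕ) + 1 = y l then (1 : ℝ) else 0) - if (j l : ℕ) = y l then 1 else 0) := by
  have hsign (ε : Fin L → Bool) : (-1 : ℝ) ^ (Finset.univ.filter fun l => ε l = true).card =
      ∏ l, if ε l then (-1 : ℝ) else 1 := by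
    simp [Finset.prod_ite]
  have hprod (y : Fin L → Fin (M + 1)) :
      ∏ l, ((if (j l : ℕ) + 1 = y l then (1 : ℝ) else 0) - if (j l : ℕ) = y l then 1 else 0) =
        ∑ ε : Fin L → Bool, (∏ l, if ε l then (-1 : ℝ) else 1) *
          ∏ l, if (if ε l then (j l : ℕ) + 1 - 1 else j l + 1) = (y l : ℕ) then (1 : ℝ) else 0 := by
    simp_rw [← Finset.prod_mul_distrib]
    rw [← Fintype.prod_sum (fun l (b : Bool) => (if b then (-1 : ℝ) else 1) *
      if (if b then (j l : ℕ) + 1 - 1 else j l + 1) = (y l : ℕ) then (1 : ℝ) else 0)]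
    refine Finset.prod_congr rfl fun l _ => ?_
    by_cases h : (j l : ℕ) = y l <;> simp [h, sub_eq_add_neg]
  unfold cellDifference
  simp_rw [hprod, Finset.mul_sum]
  rw [Finset.sum_comm]
  refine Finset.sum_congr rfl fun ε _ => ?_
  rw [hsign, eq_sum_mul_prod_indicator (M := M) D, Finset.mul_sum]
  · exact Finset.sum_congr rfl fun y _ => by ring
  · intro l
    split_ifs <;> omega

theorem sum_cellDifference {M L : ℕ} (D : (Fin L → ℕ) → ℝ)
    (hD : ∀ i : Fin L → ℕ, (∀ l, i l ≤ M) → (∃ l, i l = 0) → D i = 0)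
    (i : Fin L → ℕ) (hi : ∀ l, i l ≤ M) :
    ∑ j ∈ Finset.univ.filter (fun j : Fin L → Fin M => ∀ l, (j l : ℕ) < i l),
      cellDifference D (fun l => (j l : ℕ) + 1) = D i := by
  have hpi : Finset.univ.filter (fun j : Fin L → Fin M => ∀ l, (j l : ℕ) < i l) =
      Fintype.piFinset fun l => Finset.univ.filter fun a : Fin M => (a : ℕ) < i l := by
    ext j
    simp
  have htel (n m : ℕ) (hn : n ≤ M) : ∑ a ∈ Finset.univ.filter (fun a : Fin M => (a : ℕ) < n),
      ((if (a : ℕ) + 1 = m then (1 : ℝ) else 0) - if (a : ℕ) = m then 1 else 0) =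
      (if n = m then 1 else 0) - if 0 = m then 1 else 0 := by
    rw [← Finset.sum_range_sub (fun a => if a = m then (1 : ℝ) else 0) n]
    refine Finset.sum_bij (fun a _ => (a : ℕ)) (by simp) (fun a _ b _ h => Fin.ext h) ?_ (by simp)
    intro b hb
    rw [Finset.mem_range] at hb
    exact ⟨⟨b, by omega⟩, by simpa using hb, rfl⟩
  simp_rw [cellDifference_eq_sum_mul_prod]
  rw [Finset.sum_comm, eq_sum_mul_prod_indicator D i hi]
  refine Finset.sum_congr rfl fun y _ => ?_
  rw [← Finset.mul_sum, hpi, ← Finset.prod_univ_sum (fun l => Finset.univ.filter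
    fun a : Fin M => (a : ℕ) < i l) (fun l a => (if (a : ℕ) + 1 = y l then (1 : ℝ) else 0) -
      if (a : ℕ) = y l then 1 else 0)]
  simp_rw [fun l => htel (i l) (y l) (hi l)]
  by_cases hy : ∃ l, (y l : ℕ) = 0
  · rw [hD _ (fun l => Nat.le_of_lt_succ (y l).2) hy, zero_mul, zero_mul]
  · push Not at hy
    simp only [(hy _).symm, if_false, sub_zero]

theorem exists_int_mul_cellDifference {M L : ℕ} (hM : 1 ≤ M) (D : (Fin L → ℕ) → ℝ)
    (hD : ∀ i : Fin L → ℕ, (∀ l, i l ≤ M) → ∃ k : ℕ, D i = (k : ℝ) / M)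
    (i : Fin L → ℕ) (hi : ∀ l, i l ≤ M) :
    ∃ z : ℤ, M * cellDifference D i = z := by
  have hM0 : (M : ℝ) ≠ 0 := by positivity
  have h (ε : Fin L → Bool) : ∃ k : ℕ, D (fun l => if ε l then i l - 1 else i l) = (k : ℝ) / M :=
    hD _ fun l => by have := hi l; split_ifs <;> omega
  choose k hk using h
  refine ⟨∑ ε : Fin L → Bool, (-1) ^ (Finset.univ.filter fun l => ε l = true).card * k ε, ?_⟩
  simp only [cellDifference, hk]
  push_cast
  rw [Finset.mul_sum]
  exact Finset.sum_congr rfl fun ε _ => by field_simp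

theorem sum_cellDifference_slice {M L : ℕ} (D : (Fin L → ℕ) → ℝ)
    (hD : IsDiscreteCopula M L D) (l : Fin L) (k : Fin M) :
    ∑ j ∈ Finset.univ.filter (fun j : Fin L → Fin M => j l = k),
      cellDifference D (fun l => (j l : ℕ) + 1) = 1 / M := by
  obtain ⟨-, hground, hmargin, -⟩ := hD
  have hbox (n : ℕ) (hn : n ≤ M) :
      ∑ j ∈ Finset.univ.filter (fun j : Fin L → Fin M => (j l : ℕ) < n),
        cellDifference D (fun l => (j l : ℕ) + 1) = (n : ℝ) / M := by
    rw [← hmargin l n hn, ← sum_cellDifference D hground]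
    · refine Finset.sum_congr (Finset.filter_congr fun j _ => ⟨fun h l' => ?_, fun h => ?_⟩)
        fun _ _ => rfl
      · split_ifs with hl
        · exact hl ▸ h
        · exact (j l').2
      · simpa using h l
    · intro l'
      split_ifs <;> omega
  have hsplit : Finset.univ.filter (fun j : Fin L → Fin M => (j l : ℕ) < k + 1) =
      Finset.univ.filter (fun j : Fin L → Fin M => (j l : ℕ) < k) ∪
        Finset.univ.filter (fun j : Fin L → Fin M => j l = k) := by
    ext j
    simp only [Finset.mem_union, Finset.mem_filter_univ, Fin.ext_iff]
    omega
  have hdisj : Disjoint (Finset.univ.filter (fun j : Fin L → Fin M => (j l : ℕ) < k))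
      (Finset.univ.filter (fun j : Fin L → Fin M => j l = k)) := by
    refine Finset.disjoint_filter.mpr fun j _ h h' => ?_
    simp [h'] at h
  have hsucc := hbox (k + 1) k.2
  rw [hsplit, Finset.sum_union hdisj, hbox k k.2.le] at hsucc
  push_cast at hsucc
  rw [add_div] at hsucc
  linarith

/-- every irreducible discrete copula is represented by a permutation array. -/
theorem irreducible_exists_permutationArray (M L : ℕ) (hM : 1 ≤ M) (hL : 1 ≤ L)
    (D : (Fin L → ℕ) → ℝ) (hD : IsDiscreteCopula M L D) (hirr : IsIrreducibleOn M L D) :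
    ∃ A : (Fin L → Fin M) → ℝ, IsPermutationArray M L A ∧ Represents M L A D := by
  have hM0 : (M : ℝ) ≠ 0 := by positivity
  have hnonneg (j : Fin L → Fin M) : 0 ≤ (M : ℝ) * cellDifference D (fun l => (j l : ℕ) + 1) :=
    mul_nonneg M.cast_nonneg (hD.2.2.2 _ fun l => ⟨by omega, (j l).2⟩)
  have hslice (l : Fin L) (k : Fin M) :
      ∑ j ∈ Finset.univ.filter (fun j : Fin L → Fin M => j l = k),
        (M : ℝ) * cellDifference D (fun l => (j l : ℕ) + 1) = 1 := by
    rw [← Finset.mul_sum, sum_cellDifference_slice D hD, mul_one_div_cancel hM0]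
  refine ⟨fun j => M * cellDifference D (fun l => (j l : ℕ) + 1),
    ⟨⟨hnonneg, hslice⟩, fun j => ?_⟩, fun i hi => ?_⟩
  · have hle : (M : ℝ) * cellDifference D (fun l => (j l : ℕ) + 1) ≤ 1 := by
      rw [← hslice ⟨0, hL⟩ (j ⟨0, hL⟩)]
      exact Finset.single_le_sum
        (f := fun j : Fin L → Fin M => (M : ℝ) * cellDifference D (fun l => (j l : ℕ) + 1))
        (fun j _ => hnonneg j) (by simp)
    have hgrid (i : Fin L → ℕ) (hi : ∀ l, i l ≤ M) : ∃ k : ℕ, D i = (k : ℝ) / M := by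
      obtain ⟨k, -, hk⟩ := hirr.subset ⟨i, hi, rfl⟩
      exact ⟨k, hk⟩
    obtain ⟨z, hz⟩ := exists_int_mul_cellDifference hM D hgrid (fun l => (j l : ℕ) + 1)
      fun l => (j l).2
    have hz0 := hnonneg j
    rw [hz] at hz0 hle
    norm_cast at hz0 hle
    obtain rfl | rfl : z = 0 ∨ z = 1 := by omega
    · exact Or.inl (by simpa using hz)
    · exact Or.inr (by simpa using hz)
  · rw [← Finset.mul_sum, sum_cellDifference D hD.2.1 i hi, ← mul_assoc,
      one_div_mul_cancel hM0, one_mul]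
end

section
/- Let A = (a_{i_1⋯i_L}) be an L-dimensional permutation array. Then the function D : I_M^L → [0,1] defined by D(i_1/M,...,i_L/M) = (1/M) Σ_{j_1=1}^{i_1} ⋯ Σ_{j_L=1}^{i_L} a_{j_1⋯j_L} for i_1,...,i_L ∈ {0,1,...,M} (empty sums being 0) is an irreducible discrete copula, i.e., a discrete copula whose range equals I_M. -/
/-- In a stochastic array, the first `k` slices in direction `l` have total mass `k`. -/
theorem IsStochasticArray.sum_filter_lt {M L : ℕ} {A : (Fin L → Fin M) → ℝ}
    (hA : IsStochasticArray M L A) (l : Fin L) {k : ℕ} (hk : k ≤ M) :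
    ∑ j ∈ Finset.univ.filter (fun j : Fin L → Fin M => (j l : ℕ) < k), A j = k := by
  have hmaps : ∀ j ∈ Finset.univ.filter (fun j : Fin L → Fin M => (j l : ℕ) < k),
      j l ∈ Finset.univ.filter (fun m : Fin M => (m : ℕ) < k) := by simp
  rw [← Finset.sum_fiberwise_of_maps_to hmaps]
  have hslice : ∀ m ∈ Finset.univ.filter (fun m : Fin M => (m : ℕ) < k),
      ∑ j ∈ (Finset.univ.filter (fun j : Fin L → Fin M => (j l : ℕ) < k)).filter
        (fun j => j l = m), A j = 1 := by
    intro m hm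
    rw [← hA.2 l m]
    refine Finset.sum_congr ?_ fun _ _ => rfl
    ext j
    simp only [Finset.mem_filter, Finset.mem_univ, true_and] at hm ⊢
    exact ⟨fun h => h.2, fun h => ⟨h ▸ hm, h⟩⟩
  rw [Finset.sum_congr rfl hslice, Finset.sum_const, nsmul_one, Fin.card_filter_val_lt,
    min_eq_right hk]

/-- A function represented by a stochastic array takes values in `[0, 1]`. -/
theorem Represents.mem_Icc {M L : ℕ} {A : (Fin L → Fin M) → ℝ} {D : (Fin L → ℕ) → ℝ}
    (hD : Represents M L A D) (hA : IsStochasticArray M L A) (hM : 1 ≤ M) (hL : 1 ≤ L)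
    {i : Fin L → ℕ} (hi : ∀ l, i l ≤ M) : 0 ≤ D i ∧ D i ≤ 1 := by
  have hM' : (0 : ℝ) < M := by exact_mod_cast hM
  rw [hD i hi]
  refine ⟨mul_nonneg (by positivity) (Finset.sum_nonneg fun j _ => hA.1 j), ?_⟩
  rw [one_div_mul_eq_div, div_le_one hM', ← hA.sum_filter_lt ⟨0, hL⟩ le_rfl]
  exact Finset.sum_le_sum_of_subset_of_nonneg (fun j _ => by simp) fun j _ _ => hA.1 j

/-- A function represented by a stochastic array has uniform margins. -/
theorem Represents.margin {M L : ℕ} {A : (Fin L → Fin M) → ℝ} {D : (Fin L → ℕ) → ℝ}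
    (hD : Represents M L A D) (hA : IsStochasticArray M L A) (l : Fin L) {k : ℕ} (hk : k ≤ M) :
    D (fun l' => if l' = l then k else M) = (k : ℝ) / M := by
  rw [hD _ (fun l' => by split_ifs <;> simp [hk]), one_div_mul_eq_div,
    ← hA.sum_filter_lt l hk]
  congr 2
  ext j
  simp only [Finset.mem_filter, Finset.mem_univ, true_and]
  refine ⟨fun h => by simpa using h l, fun h l' => ?_⟩
  split_ifs with hl
  · exact hl ▸ h
  · exact (j l').2

/-- The alternating sum of box indicators is a product of one-dimensional differences. -/
theorem sum_neg_one_pow_mul_indicator_nonneg {L : ℕ} (i j : Fin L → ℕ) :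
    (0 : ℝ) ≤ ∑ ε : Fin L → Bool,
      (-1 : ℝ) ^ (Finset.univ.filter fun l => ε l = true).card *
        if ∀ l, j l < (if ε l then i l - 1 else i l) then 1 else 0 := by
  have hfactor : ∀ ε : Fin L → Bool,
      ((-1 : ℝ) ^ (Finset.univ.filter fun l => ε l = true).card *
        if ∀ l, j l < (if ε l then i l - 1 else i l) then 1 else 0) =
      ∏ l, (if ε l = true then (-1 : ℝ) else 1) *
        (if j l < (if ε l then i l - 1 else i l) then 1 else 0) := by
    intro ε
    rw [Finset.prod_mul_distrib, Finset.prod_ite, Finset.prod_const, Finset.prod_const_one,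
      mul_one, Finset.prod_ite_zero]
    simp
  rw [Finset.sum_congr rfl fun ε _ => hfactor ε,
    ← Fintype.prod_sum fun l (b : Bool) => (if b = true then (-1 : ℝ) else 1) *
        (if j l < (if b then i l - 1 else i l) then 1 else 0)]
  refine Finset.prod_nonneg fun l _ => ?_
  simp only [Fintype.sum_bool]
  have : j l < i l - 1 → j l < i l := fun h => by omega
  by_cases h1 : j l < i l - 1
  · simp [h1, this h1]
  · by_cases h2 : j l < i l <;> simp [h1, h2]

/-- A function represented by a stochastic array is a discrete copula. -/
theorem Represents.isDiscreteCopula {M L : ℕ} {A : (Fin L → Fin M) → ℝ} {D : (Fin L → ℕ) → ℝ}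
    (hD : Represents M L A D) (hA : IsStochasticArray M L A) (hM : 1 ≤ M) (hL : 1 ≤ L) :
    IsDiscreteCopula M L D := by
  refine ⟨fun i hi => hD.mem_Icc hA hM hL hi, fun i hi ⟨l, hl⟩ => ?_,
    fun l k hk => hD.margin hA l hk, fun i hi => ?_⟩
  · rw [hD i hi, Finset.filter_false_of_mem, Finset.sum_empty, mul_zero]
    intro j _ h
    simpa [hl] using h l
  · have hexpand : ∀ ε : Fin L → Bool, D (fun l => if ε l then i l - 1 else i l) =
        ∑ j : Fin L → Fin M, (1 / M * A j) *
          if ∀ l, (j l : ℕ) < (if ε l then i l - 1 else i l) then 1 else 0 := by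
      intro ε
      rw [hD _ fun l => by have := (hi l).2; split_ifs <;> omega, Finset.sum_filter,
        Finset.mul_sum]
      refine Finset.sum_congr rfl fun j _ => ?_
      split_ifs <;> simp
    simp_rw [hexpand, Finset.mul_sum]
    rw [Finset.sum_comm]
    simp_rw [mul_left_comm _ (1 / (M : ℝ) * A _), ← Finset.mul_sum]
    exact Finset.sum_nonneg fun j _ => mul_nonneg (mul_nonneg (by positivity) (hA.1 j))
      (sum_neg_one_pow_mul_indicator_nonneg i fun l => (j l : ℕ))

/-- the function defined from a permutation array is an
irreducible discrete copula. -/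
theorem permutationArray_irreducible_discreteCopula (M L : ℕ) (hM : 1 ≤ M) (hL : 1 ≤ L)
    (A : (Fin L → Fin M) → ℝ) (hA : IsPermutationArray M L A)
    (D : (Fin L → ℕ) → ℝ) (hD : Represents M L A D) :
    IsDiscreteCopula M L D ∧ IsIrreducibleOn M L D := by
  have hM' : (0 : ℝ) < M := by exact_mod_cast hM
  refine ⟨hD.isDiscreteCopula hA.1 hM hL, Set.ext fun y => ⟨?_, ?_⟩⟩
  · rintro ⟨i, hi, rfl⟩
    have hnat : ∀ j, A j = ((if A j = 1 then 1 else 0 : ℕ) : ℝ) := fun j => by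
      rcases hA.2 j with h | h <;> simp [h]
    have hle := (hD.mem_Icc hA.1 hM hL hi).2
    rw [hD i hi, one_div_mul_eq_div, Finset.sum_congr rfl fun j _ => hnat j,
      ← Nat.cast_sum] at hle
    refine ⟨_, by exact_mod_cast (div_le_one hM').1 hle, ?_⟩
    rw [hD i hi, one_div_mul_eq_div, Finset.sum_congr rfl fun j _ => hnat j, ← Nat.cast_sum]
  · rintro ⟨k, hk, rfl⟩
    exact ⟨fun l' => if l' = ⟨0, hL⟩ then k else M,
      fun l' => by beta_reduce; split_ifs <;> simp [hk],
      hD.margin hA.1 ⟨0, hL⟩ hk⟩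
end

section
/- The empirical copula E_M of a tie-free set S of M points in ℝ^L is an irreducible discrete copula, i.e., a discrete copula whose range equals I_M. -/
/-- An injection of `Fin M` into `{1, …, M}` takes exactly `k` values that are at most `k`. -/
theorem card_filter_le_of_injective {M : ℕ} {r : Fin M → ℕ} (hr : Function.Injective r)
    (hmem : ∀ m, 1 ≤ r m ∧ r m ≤ M) {k : ℕ} (hk : k ≤ M) :
    (Finset.univ.filter fun m => r m ≤ k).card = k := by
  have himage : Finset.univ.image r = Finset.Icc 1 M := by
    apply Finset.eq_of_subset_of_card_le
    · intro y hy
      obtain ⟨m, -, rfl⟩ := Finset.mem_image.1 hy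
      exact Finset.mem_Icc.2 (hmem m)
    · simp [Finset.card_image_of_injective _ hr]
  have hfilter : (Finset.univ.filter fun m => r m ≤ k).image r = Finset.Icc 1 k := by
    ext y
    simp only [Finset.mem_image, Finset.mem_filter, Finset.mem_univ, true_and, Finset.mem_Icc]
    constructor
    · rintro ⟨m, hm, rfl⟩
      exact ⟨(hmem m).1, hm⟩
    · rintro ⟨h1, h2⟩
      have hy : y ∈ Finset.univ.image r := himage ▸ Finset.mem_Icc.2 ⟨h1, h2.trans hk⟩
      obtain ⟨m, -, rfl⟩ := Finset.mem_image.1 hy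
      exact ⟨m, h2, rfl⟩
  rw [← Finset.card_image_of_injective _ hr, hfilter]
  simp

/-- The iterated unit difference of the indicator of an orthant factors over the coordinates. -/
theorem sum_neg_one_pow_mul_indicator_le {L : ℕ} (r i : Fin L → ℕ) :
    ∑ ε : Fin L → Bool, (-1 : ℝ) ^ (Finset.univ.filter fun l => ε l = true).card *
        (if ∀ l, r l ≤ (if ε l then i l - 1 else i l) then 1 else 0) =
      ∏ l, ((if r l ≤ i l then (1 : ℝ) else 0) - if r l ≤ i l - 1 then 1 else 0) := by
  have hfactor : ∀ l, ((if r l ≤ i l then (1 : ℝ) else 0) - if r l ≤ i l - 1 then 1 else 0) =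
      ∑ b : Bool, (if b = true then (-1 : ℝ) else 1) *
        if r l ≤ (if b then i l - 1 else i l) then 1 else 0 := by
    intro l
    simp only [Fintype.sum_bool, if_true, Bool.false_eq_true, if_false]
    ring
  simp only [hfactor]
  rw [Finset.prod_univ_sum, Fintype.piFinset_univ]
  refine Finset.sum_congr rfl fun ε _ => ?_
  rw [Finset.prod_mul_distrib, Finset.prod_ite, Finset.prod_const, Finset.prod_const_one, mul_one]
  congr 1
  rw [Finset.prod_ite_zero]
  simp

/-- Iterated unit differences of the function counting points in an orthant are nonnegative. -/
theorem sum_neg_one_pow_mul_card_filter_le_nonneg {M L : ℕ} (r : Fin M → Fin L → ℕ)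
    (i : Fin L → ℕ) :
    0 ≤ ∑ ε : Fin L → Bool, (-1 : ℝ) ^ (Finset.univ.filter fun l => ε l = true).card *
      ((Finset.univ.filter fun m => ∀ l, r m l ≤ (if ε l then i l - 1 else i l)).card : ℝ) := by
  simp only [Finset.natCast_card_filter, Finset.mul_sum]
  rw [Finset.sum_comm]
  refine Finset.sum_nonneg fun m _ => ?_
  rw [sum_neg_one_pow_mul_indicator_le (r m) i]
  refine Finset.prod_nonneg fun l _ => ?_
  split_ifs <;> first | omega | norm_num

/-- the empirical copula of a tie-free set
`S = {(x m 0, …, x m (L-1)) : m}` of `M` points in `ℝ^L` is an irreducible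
discrete copula.  Here `ord l 1 < ⋯ < ord l M` are the order statistics of
`x · l`, and `E` is the empirical copula of `S`. -/
theorem empiricalCopula_isIrreducibleDiscreteCopula (M L : ℕ) (hM : 1 ≤ M) (hL : 1 ≤ L)
    (x : Fin M → Fin L → ℝ)
    (htiefree : ∀ l : Fin L, Function.Injective fun m => x m l)
    (ord : Fin L → ℕ → ℝ)
    (hord_mono : ∀ l : Fin L, ∀ r s : ℕ, 1 ≤ r → r < s → s ≤ M → ord l r < ord l s)
    (hord_range : ∀ l : Fin L,
      {y : ℝ | ∃ r : ℕ, 1 ≤ r ∧ r ≤ M ∧ y = ord l r} = Set.range fun m => x m l)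
    (E : (Fin L → ℕ) → ℝ)
    (hE0 : ∀ i : Fin L → ℕ, (∀ l, i l ≤ M) → (∃ l, i l = 0) → E i = 0)
    (hE1 : ∀ i : Fin L → ℕ, (∀ l, 1 ≤ i l ∧ i l ≤ M) →
      E i = (1 / M) * ((Finset.univ.filter fun m : Fin M =>
          ∀ l : Fin L, x m l ≤ ord l (i l)).card : ℝ)) :
    IsDiscreteCopula M L E ∧ IsIrreducibleOn M L E := by
  have hMpos : (0 : ℝ) < M := by exact_mod_cast hM
  have hrank : ∀ m l, ∃ k, 1 ≤ k ∧ k ≤ M ∧ x m l = ord l k := fun m l =>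
    (hord_range l).symm.subset ⟨m, rfl⟩
  choose r hr_pos hr_le hr_eq using hrank
  have hr_inj : ∀ l, Function.Injective fun m => r m l := fun l m m' h =>
    htiefree l <| by
      have h' : r m l = r m' l := h
      simp only [hr_eq, h']
  have hle_iff : ∀ m l k, 1 ≤ k → k ≤ M → (x m l ≤ ord l k ↔ r m l ≤ k) := by
    intro m l k hk hkM
    rw [hr_eq]
    constructor
    · intro h
      by_contra! hlt
      exact absurd (hord_mono l _ _ hk hlt (hr_le m l)) (not_lt.2 h)
    · intro h
      rcases h.eq_or_lt with h | h
      · rw [h]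
      · exact (hord_mono l _ _ (hr_pos m l) h hkM).le
  have hE : ∀ i : Fin L → ℕ, (∀ l, i l ≤ M) →
      E i = (1 / M) * ((Finset.univ.filter fun m => ∀ l, r m l ≤ i l).card : ℝ) := by
    intro i hi
    by_cases h0 : ∃ l, i l = 0
    · obtain ⟨l, hl⟩ := h0
      have hempty : (Finset.univ.filter fun m => ∀ l, r m l ≤ i l) = ∅ :=
        Finset.filter_eq_empty_iff.2 fun m _ h => by
          have := h l
          have := hr_pos m l
          omega
      rw [hE0 i hi ⟨l, hl⟩, hempty]
      simp
    · have hpos : ∀ l, 1 ≤ i l := fun l => Nat.one_le_iff_ne_zero.2 fun h => h0 ⟨l, h⟩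
      rw [hE1 i fun l => ⟨hpos l, hi l⟩]
      simp only [hle_iff _ _ _ (hpos _) (hi _)]
  have hcard : ∀ i : Fin L → ℕ, (Finset.univ.filter fun m => ∀ l, r m l ≤ i l).card ≤ M :=
    fun i => (Finset.card_le_univ _).trans_eq (Fintype.card_fin M)
  have hmargin_le : ∀ (l : Fin L) (k : ℕ), k ≤ M → ∀ l', (if l' = l then k else M) ≤ M := by
    intro l k hk l'
    split_ifs <;> omega
  have hmargin : ∀ (l : Fin L) (k : ℕ), k ≤ M →
      E (fun l' => if l' = l then k else M) = (k : ℝ) / M := by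
    intro l k hk
    have hset : ∀ m, (∀ l', r m l' ≤ (if l' = l then k else M)) ↔ r m l ≤ k := by
      refine fun m => ⟨fun h => by simpa using h l, fun h l' => ?_⟩
      split_ifs with hl
      · exact hl ▸ h
      · exact hr_le m l'
    rw [hE _ (hmargin_le l k hk)]
    simp only [hset]
    rw [card_filter_le_of_injective (hr_inj l) (fun m => ⟨hr_pos m l, hr_le m l⟩) hk]
    ring
  refine ⟨⟨fun i hi => ?_, hE0, hmargin, fun i hi => ?_⟩, ?_⟩
  · rw [hE i hi, one_div_mul_eq_div]
    exact ⟨by positivity, (div_le_one hMpos).2 (by exact_mod_cast hcard i)⟩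
  · have hvalid : ∀ (ε : Fin L → Bool) l, (if ε l then i l - 1 else i l) ≤ M := by
      intro ε l
      have := (hi l).2
      split_ifs <;> omega
    simp only [hE _ (hvalid _), mul_left_comm _ (1 / (M : ℝ)), ← Finset.mul_sum]
    exact mul_nonneg (by positivity) (sum_neg_one_pow_mul_card_filter_le_nonneg r i)
  · ext y
    constructor
    · rintro ⟨i, hi, rfl⟩
      exact ⟨_, hcard i, by rw [hE i hi, one_div_mul_eq_div]⟩
    · rintro ⟨k, hk, rfl⟩
      exact ⟨_, hmargin_le ⟨0, hL⟩ k hk, hmargin ⟨0, hL⟩ k hk⟩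
end

section
/- Let S be a tie-free set of M points in ℝ^L with empirical copula E_M. Define the array A = (a_{i_1⋯i_L}) by a_{i_1⋯i_L} = 1 if (x_{(i_1)}^1,...,x_{(i_L)}^L) ∈ S and a_{i_1⋯i_L} = 0 otherwise. Then A is an L-dimensional permutation array and E_M(i_1/M,...,i_L/M) = (1/M) Σ_{j_1=1}^{i_1} ⋯ Σ_{j_L=1}^{i_L} a_{j_1⋯j_L} for all i_1,...,i_L ∈ {0,1,...,M}. -/
/-- Summing the indicator of the range of an injective map `p` over the elements satisfying `P`
counts the points whose image satisfies `P`. -/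
theorem sum_filter_indicator_range_eq_card {α β : Type*} [Fintype α] [Fintype β]
    {p : α → β} (hp : Function.Injective p) (P : β → Prop) [DecidablePred P]
    [DecidablePred fun j => ∃ m, p m = j] :
    ∑ j ∈ Finset.univ.filter P, (if ∃ m, p m = j then (1 : ℝ) else 0) =
      ((Finset.univ.filter fun m => P (p m)).card : ℝ) := by
  classical
  rw [Finset.sum_boole, ← Finset.card_image_of_injective _ hp]
  congr 2
  ext j
  simp only [Finset.mem_filter, Finset.mem_univ, true_and, Finset.mem_image]
  constructor
  · rintro ⟨hj, m, rfl⟩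
    exact ⟨m, hj, rfl⟩
  · rintro ⟨m, hm, rfl⟩
    exact ⟨hm, m, rfl⟩

/-- the `0/1` array recording which points
`(x_{(i₁)}^1,…,x_{(i_L)}^L)` belong to a tie-free set `S` is a permutation
array and represents the empirical copula of `S`.  Here
`ord l 1 < ⋯ < ord l M` are the order statistics of `x · l`, `E` is the
empirical copula of `S`, and the array index `j l : Fin M` stands for
`i_ℓ = j l + 1`. -/
theorem empiricalCopula_permutationArray (M L : ℕ) (hM : 1 ≤ M) (hL : 1 ≤ L)
    (x : Fin M → Fin L → ℝ)
    (htiefree : ∀ l : Fin L, Function.Injective fun m => x m l)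
    (ord : Fin L → ℕ → ℝ)
    (hord_mono : ∀ l : Fin L, ∀ r s : ℕ, 1 ≤ r → r < s → s ≤ M → ord l r < ord l s)
    (hord_range : ∀ l : Fin L,
      {y : ℝ | ∃ r : ℕ, 1 ≤ r ∧ r ≤ M ∧ y = ord l r} = Set.range fun m => x m l)
    (E : (Fin L → ℕ) → ℝ)
    (hE0 : ∀ i : Fin L → ℕ, (∀ l, i l ≤ M) → (∃ l, i l = 0) → E i = 0)
    (hE1 : ∀ i : Fin L → ℕ, (∀ l, 1 ≤ i l ∧ i l ≤ M) →
      E i = (1 / M) * ((Finset.univ.filter fun m : Fin M =>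
          ∀ l : Fin L, x m l ≤ ord l (i l)).card : ℝ)) :
    IsPermutationArray M L
      (fun j : Fin L → Fin M =>
        if ∃ m : Fin M, ∀ l : Fin L, x m l = ord l ((j l : ℕ) + 1) then (1 : ℝ) else 0) ∧
    Represents M L
      (fun j : Fin L → Fin M =>
        if ∃ m : Fin M, ∀ l : Fin L, x m l = ord l ((j l : ℕ) + 1) then (1 : ℝ) else 0)
      E := by
  have hmono (l : Fin L) : StrictMonoOn (ord l) (Set.Icc 1 M) :=
    fun r hr s hs hrs => hord_mono l r s hr.1 hrs hs.2
  have hmem (k : Fin M) : (k : ℕ) + 1 ∈ Set.Icc 1 M := ⟨by omega, by omega⟩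
  have hrank (m : Fin M) (l : Fin L) : ∃ k : Fin M, x m l = ord l ((k : ℕ) + 1) := by
    have hx : x m l ∈ {y : ℝ | ∃ r : ℕ, 1 ≤ r ∧ r ≤ M ∧ y = ord l r} :=
      hord_range l ▸ Set.mem_range_self m
    obtain ⟨r, hr1, hrM, hr⟩ := hx
    refine ⟨⟨r - 1, by omega⟩, ?_⟩
    simpa [Nat.sub_add_cancel hr1] using hr
  choose p hp using hrank
  have hp_coord (l : Fin L) : Function.Injective fun m => p m l := by
    intro a b hab
    apply htiefree l
    have hab' : p a l = p b l := hab
    simp only [hp, hab']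
  have hp_inj : Function.Injective p := fun a b hab =>
    hp_coord ⟨0, hL⟩ (congrFun hab _)
  have hA : (fun j : Fin L → Fin M =>
        if ∃ m : Fin M, ∀ l : Fin L, x m l = ord l ((j l : ℕ) + 1) then (1 : ℝ) else 0) =
      fun j => if ∃ m, p m = j then (1 : ℝ) else 0 := by
    funext j
    refine if_congr (exists_congr fun m => ?_) rfl rfl
    rw [funext_iff]
    refine forall_congr' fun l => ?_
    rw [hp, (hmono l).injOn.eq_iff (hmem _) (hmem _), Nat.add_right_cancel_iff, Fin.ext_iff]
  rw [hA]
  refine ⟨⟨⟨fun j => ?_, fun l k => ?_⟩, fun j => ?_⟩, fun i hi => ?_⟩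
  · positivity
  · beta_reduce
    rw [sum_filter_indicator_range_eq_card hp_inj, Nat.cast_eq_one, Finset.card_eq_one]
    obtain ⟨m, hm⟩ := Finite.surjective_of_injective (hp_coord l) k
    refine ⟨m, ?_⟩
    ext a
    simp only [Finset.mem_filter, Finset.mem_univ, true_and, Finset.mem_singleton]
    rw [← hm]
    exact (hp_coord l).eq_iff
  · exact (ite_eq_or_eq _ _ _).symm
  · beta_reduce
    rw [sum_filter_indicator_range_eq_card hp_inj]
    by_cases h0 : ∃ l, i l = 0
    · rw [hE0 i hi h0]
      obtain ⟨l, hl⟩ := h0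
      rw [Finset.filter_false_of_mem fun m _ h => by simpa [hl] using h l]
      simp
    · push Not at h0
      have hi' (l : Fin L) : 1 ≤ i l ∧ i l ≤ M := ⟨Nat.one_le_iff_ne_zero.2 (h0 l), hi l⟩
      rw [hE1 i hi']
      congr 3
      ext m
      simp only [Finset.mem_filter, Finset.mem_univ, true_and]
      refine forall_congr' fun l => ?_
      rw [hp, (hmono l).le_iff_le (hmem _) (hi' l), Nat.succ_le_iff]
end

section
/- Let D be an irreducible discrete copula on I_M^L represented by the L-dimensional permutation array A = (a_{i_1⋯i_L}), and let 𝒳^ℓ = {x_1^ℓ < ⋯ < x_M^ℓ} be arbitrary strictly increasing sequences of real numbers for ℓ = 1,...,L. Then D is the empirical copula of the set S = {(x_{i_1}^1,...,x_{i_L}^L) : a_{i_1⋯i_L} = 1}. -/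
/-- Every slab `j l = k` of a permutation array contains an entry equal to `1`. -/
theorem IsPermutationArray.exists_eq_one {M L : ℕ} {A : (Fin L → Fin M) → ℝ}
    (hA : IsPermutationArray M L A) (l : Fin L) (k : Fin M) :
    ∃ j, j l = k ∧ A j = 1 := by
  have hne : ∑ j ∈ Finset.univ.filter (fun j : Fin L → Fin M => j l = k), A j ≠ 0 := by
    rw [hA.1.2 l k]
    exact one_ne_zero
  obtain ⟨j, hj, hj0⟩ := Finset.exists_ne_zero_of_sum_ne_zero hne
  exact ⟨j, (Finset.mem_filter.mp hj).2, (hA.2 j).resolve_left hj0⟩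

/-- A map from `Fin M` covering the support of an `M`-permutation array of positive dimension
is injective. -/
theorem IsPermutationArray.injective_of_covers {M L : ℕ} {A : (Fin L → Fin M) → ℝ}
    (hA : IsPermutationArray M L A) (hL : 1 ≤ L) {e : Fin M → Fin L → Fin M}
    (he : ∀ j : Fin L → Fin M, A j = 1 → ∃ m : Fin M, e m = j) :
    Function.Injective e := by
  let l : Fin L := ⟨0, hL⟩
  have hsurj : Function.Surjective fun m => e m l := by
    intro k
    obtain ⟨j, hjk, hj⟩ := hA.exists_eq_one l k
    obtain ⟨m, rfl⟩ := he j hj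
    exact ⟨m, hjk⟩
  intro a b hab
  exact Finite.injective_iff_surjective.mpr hsurj (congrFun hab l)

/-- Summing a `0`-`1` array over a set of indices counts the points of an enumeration of its
support that lie in this set. -/
theorem IsPermutationArray.sum_filter_eq_card {M L : ℕ} {A : (Fin L → Fin M) → ℝ}
    (hA : IsPermutationArray M L A) (hL : 1 ≤ L) {e : Fin M → Fin L → Fin M}
    (he1 : ∀ m : Fin M, A (e m) = 1)
    (he2 : ∀ j : Fin L → Fin M, A j = 1 → ∃ m : Fin M, e m = j)
    (p : (Fin L → Fin M) → Prop) [DecidablePred p] :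
    ∑ j ∈ Finset.univ.filter p, A j =
      ((Finset.univ.filter fun m => p (e m)).card : ℝ) := by
  rw [Finset.card_eq_sum_ones, Nat.cast_sum]
  symm
  refine Finset.sum_of_injOn e (hA.injective_of_covers hL he2).injOn ?_ ?_ ?_
  · intro m hm
    simpa using hm
  · intro j hj hje
    refine (hA.2 j).resolve_right fun h1 => hje ?_
    obtain ⟨m, rfl⟩ := he2 j h1
    exact ⟨m, by simpa using hj, rfl⟩
  · intro m _
    simp [he1 m]

/-- an irreducible discrete copula `D` represented by a
permutation array `A` is the empirical copula of the set
`S = {(y^1_{j₁},…,y^L_{j_L}) : a_{j₁⋯j_L} = 1}`, for arbitrary strictly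
increasing sequences `y l 1 < ⋯ < y l M`.  The map `e` enumerates the points
of `S` (i.e. the indices `j` with `A j = 1`, where `j l : Fin M` stands for
`j l + 1 ∈ {1,…,M}`), and `E` is the empirical copula of `S`, whose points are
`(y l ((e m l) + 1))_{l}` for `m = 1,…,M`, the order statistics in coordinate
`l` being `y l 1 < ⋯ < y l M`. -/
theorem irreducibleCopula_is_empiricalCopula (M L : ℕ) (hM : 1 ≤ M) (hL : 1 ≤ L)
    (D : (Fin L → ℕ) → ℝ) (hD : IsDiscreteCopula M L D) (hirr : IsIrreducibleOn M L D)
    (A : (Fin L → Fin M) → ℝ) (hA : IsPermutationArray M L A)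
    (hrep : Represents M L A D)
    (y : Fin L → ℕ → ℝ)
    (hy : ∀ l : Fin L, ∀ r s : ℕ, 1 ≤ r → r < s → s ≤ M → y l r < y l s)
    (e : Fin M → Fin L → Fin M)
    (he1 : ∀ m : Fin M, A (e m) = 1)
    (he2 : ∀ j : Fin L → Fin M, A j = 1 → ∃ m : Fin M, e m = j)
    (E : (Fin L → ℕ) → ℝ)
    (hE0 : ∀ i : Fin L → ℕ, (∀ l, i l ≤ M) → (∃ l, i l = 0) → E i = 0)
    (hE1 : ∀ i : Fin L → ℕ, (∀ l, 1 ≤ i l ∧ i l ≤ M) →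
      E i = (1 / M) * ((Finset.univ.filter fun m : Fin M =>
          ∀ l : Fin L, y l ((e m l : ℕ) + 1) ≤ y l (i l)).card : ℝ)) :
    ∀ i : Fin L → ℕ, (∀ l, i l ≤ M) → D i = E i := by
  intro i hi
  by_cases h0 : ∃ l, i l = 0
  · rw [hD.2.1 i hi h0, hE0 i hi h0]
  push Not at h0
  have hpos : ∀ l, 1 ≤ i l := fun l => Nat.one_le_iff_ne_zero.mpr (h0 l)
  have hle : ∀ (m : Fin M) (l : Fin L),
      (e m l : ℕ) < i l ↔ y l ((e m l : ℕ) + 1) ≤ y l (i l) := by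
    intro m l
    have hmono : StrictMonoOn (y l) (Set.Icc 1 M) := fun r hr s hs hrs =>
      hy l r s hr.1 hrs hs.2
    rw [hmono.le_iff_le ⟨Nat.le_add_left _ _, (e m l).isLt⟩ ⟨hpos l, hi l⟩, Nat.succ_le_iff]
  rw [hrep i hi, hE1 i fun l => ⟨hpos l, hi l⟩, hA.sum_filter_eq_card hL he1 he2]
  simp only [hle]
end

section
/- (Extension lemma) For every irreducible discrete subcopula D* : J_M^{(1)} × ⋯ × J_M^{(L)} → I_M there exists an irreducible discrete copula D : I_M^L → I_M whose restriction to J_M^{(1)} × ⋯ × J_M^{(L)} coincides with D*. -/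
/-- `D` is a discrete subcopula on `J 0 × ⋯ × J (L-1)`, where each `J l` is a
subset of `{0,1,…,M}` (encoding `J_M^{(l)} ⊆ I_M`) containing `0` and `M`. -/
def IsDiscreteSubcopula (M L : ℕ) (J : Fin L → Finset ℕ) (D : (Fin L → ℕ) → ℝ) : Prop :=
  -- the domain sets satisfy {0,1} ⊆ J_M^{(ℓ)} ⊆ I_M
  (∀ l : Fin L, J l ⊆ Finset.range (M + 1) ∧ 0 ∈ J l ∧ M ∈ J l) ∧
  -- values in [0,1]
  (∀ i : Fin L → ℕ, (∀ l, i l ∈ J l) → 0 ≤ D i ∧ D i ≤ 1) ∧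
  -- (S1) groundedness
  (∀ i : Fin L → ℕ, (∀ l, i l ∈ J l) → (∃ l, i l = 0) → D i = 0) ∧
  -- (S2) margins
  (∀ l : Fin L, ∀ k ∈ J l,
      D (fun l' => if l' = l then k else M) = (k : ℝ) / M) ∧
  -- (S3) L-increasing: every iterated difference over a box with vertices in
  -- the domain is nonnegative
  (∀ a b : Fin L → ℕ, (∀ l, a l ∈ J l) → (∀ l, b l ∈ J l) → (∀ l, a l ≤ b l) →
      0 ≤ ∑ ε : Fin L → Bool,
        (-1 : ℝ) ^ (Finset.univ.filter fun l => ε l = true).card *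
          D (fun l => if ε l then a l else b l))

/-- A discrete subcopula is irreducible if all its values lie in `I_M`. -/
def SubcopulaIrreducible (M L : ℕ) (J : Fin L → Finset ℕ) (D : (Fin L → ℕ) → ℝ) : Prop :=
  ∀ i : Fin L → ℕ, (∀ l, i l ∈ J l) → ∃ k : ℕ, k ≤ M ∧ D i = (k : ℝ) / M

open Finset in
/-- The alternating sum over the vertices of a box of a product function factors. -/
theorem sum_alternating_prod {ι : Type*} [Fintype ι] [DecidableEq ι] (f : ι → ℕ → ℝ)
    (a b : ι → ℕ) :
    ∑ ε : ι → Bool, (-1 : ℝ) ^ (univ.filter fun l => ε l = true).card *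
        ∏ l, f l (if ε l then a l else b l) = ∏ l, (f l (b l) - f l (a l)) := by
  have h : ∀ l, f l (b l) - f l (a l) =
      ∑ e : Bool, (if e = true then (-1 : ℝ) else 1) * f l (if e then a l else b l) := by
    intro l
    simp
    ring
  simp_rw [h]
  rw [prod_univ_sum, Fintype.piFinset_univ]
  refine sum_congr rfl fun ε _ => ?_
  rw [prod_mul_distrib, prod_ite]
  simp

open Finset in
/-- A grounded function is recovered by summing its unit box differences. -/
theorem sum_box_differences {ι : Type*} [Fintype ι] [DecidableEq ι] (E : (ι → ℕ) → ℝ)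
    (hE : ∀ j, (∃ l, j l = 0) → E j = 0) (i : ι → ℕ) :
    ∑ j ∈ Fintype.piFinset (fun l => range (i l)),
      ∑ ε : ι → Bool, (-1 : ℝ) ^ (univ.filter fun l => ε l = true).card *
        E (fun l => if ε l then j l else j l + 1) = E i := by
  have expand : ∀ x : ι → ℕ, (∀ l, x l ≤ i l) →
      E x = ∑ k ∈ Fintype.piFinset (fun l => range (i l + 1)),
        E k * ∏ l, (if x l = k l then (1 : ℝ) else 0) := by
    intro x hx
    rw [sum_eq_single x]
    · simp
    · intro k _ hk
      obtain ⟨l, hl⟩ := Function.ne_iff.1 hk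
      rw [prod_eq_zero (mem_univ l) (if_neg (Ne.symm hl)), mul_zero]
    · intro h
      exact absurd (Fintype.mem_piFinset.2 fun l =>
        mem_range.2 (Nat.lt_succ_of_le (hx l))) h
  have inner : ∀ j ∈ Fintype.piFinset (fun l => range (i l)),
      ∑ ε : ι → Bool, (-1 : ℝ) ^ (univ.filter fun l => ε l = true).card *
        E (fun l => if ε l then j l else j l + 1) =
      ∑ k ∈ Fintype.piFinset (fun l => range (i l + 1)), E k *
        ∏ l, ((if j l + 1 = k l then (1 : ℝ) else 0) - if j l = k l then 1 else 0) := by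
    intro j hj
    have hj' : ∀ l, j l < i l := fun l => mem_range.1 (Fintype.mem_piFinset.1 hj l)
    have h : ∀ ε : ι → Bool, E (fun l => if ε l then j l else j l + 1) = _ :=
      fun ε => expand _ fun l => by
        have := hj' l
        split_ifs <;> omega
    simp_rw [h, mul_sum]
    rw [sum_comm]
    refine sum_congr rfl fun k _ => ?_
    rw [← sum_alternating_prod (fun l x => if x = k l then (1 : ℝ) else 0) j
      (fun l => j l + 1), mul_sum]
    exact sum_congr rfl fun ε _ => by ring
  rw [sum_congr rfl inner, sum_comm, expand i fun _ => le_rfl]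
  refine sum_congr rfl fun k _ => ?_
  rw [← mul_sum, ← prod_univ_sum (fun l => range (i l))
    (fun l x => (if x + 1 = k l then (1 : ℝ) else 0) - if x = k l then 1 else 0)]
  by_cases hk : ∃ l, k l = 0
  · rw [hE k hk, zero_mul, zero_mul]
  · push Not at hk
    congr 1
    refine prod_congr rfl fun l _ => ?_
    rw [sum_range_sub (fun x => if x = k l then (1 : ℝ) else 0), if_neg (hk l).symm, sub_zero]

open Finset in
/-- Prescribed multiplicities with total `M` are realized by a family of `M` points. -/
theorem exists_family_of_multiplicities {α : Type*} (s : Finset α) (m : α → ℕ) (M : ℕ)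
    (hM : ∑ a ∈ s, m a = M) :
    ∃ Q : Fin M → α, ∀ (p : α → Prop) [DecidablePred p],
      (univ.filter fun x => p (Q x)).card = ∑ a ∈ s.filter p, m a := by
  have hcard : Fintype.card (Σ a : s, Fin (m a)) = M := by
    rw [Fintype.card_sigma]
    simp only [Fintype.card_fin]
    rw [← hM, ← sum_coe_sort s m]
  let e := Fintype.equivFinOfCardEq hcard
  refine ⟨fun x => (e.symm x).1, fun p _ => ?_⟩
  rw [card_filter, e.symm.sum_comp (fun y => if p (y.1 : α) then 1 else 0), Fintype.sum_sigma,
    sum_filter, ← sum_coe_sort s]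
  refine sum_congr rfl fun a _ => ?_
  split_ifs <;> simp

open Finset in
/-- Ranking the values of `f` turns each sublevel set `{f < k}` of size `k` into `{0, …, k - 1}`. -/
theorem exists_ranking {M : ℕ} (f : Fin M → ℕ) :
    ∃ σ : Equiv.Perm (Fin M), ∀ k, (univ.filter fun x => f x < k).card = k →
      ∀ x, (σ x : ℕ) < k ↔ f x < k := by
  have hmono : Monotone (f ∘ Tuple.sort f) := Tuple.monotone_sort f
  refine ⟨(Tuple.sort f).symm, fun k hk x => ?_⟩
  have hcard : (univ.filter fun y => f (Tuple.sort f y) < k).card = k := by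
    refine Eq.trans ?_ hk
    rw [card_filter, card_filter,
      Equiv.sum_comp (Tuple.sort f) (fun y => if f y < k then 1 else 0)]
  obtain ⟨y, rfl⟩ := (Tuple.sort f).surjective x
  rw [Equiv.symm_apply_apply]
  constructor
  · intro hy
    by_contra hf
    have hsub : (univ.filter fun z => f (Tuple.sort f z) < k) ⊆ Iio y := by
      intro z hz
      rw [mem_Iio]
      by_contra hyz
      have := hmono (not_lt.1 hyz)
      simp only [mem_filter, mem_univ, true_and, Function.comp] at hz this
      omega
    have := card_le_card hsub
    rw [hcard, Fin.card_Iio] at this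
    omega
  · intro hf
    have hsub : Iic y ⊆ univ.filter fun z => f (Tuple.sort f z) < k := by
      intro z hz
      have := hmono (mem_Iic.1 hz)
      simp only [mem_filter, mem_univ, true_and, Function.comp] at this ⊢
      omega
    have := card_le_card hsub
    rw [hcard, Fin.card_Iic] at this
    omega

/-- A finite set of naturals containing `0` admits a monotone retraction. -/
theorem exists_monotone_retraction (S : Finset ℕ) (h0 : 0 ∈ S) :
    ∃ r : ℕ → ℕ, (∀ x, r x ∈ S) ∧ Monotone r ∧ ∀ k ∈ S, r k = k := by
  refine ⟨fun x => (S.filter (· ≤ x)).sup id, fun x => ?_, fun x y hxy => ?_, fun k hk => ?_⟩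
  · obtain ⟨k, hk, he⟩ := Finset.exists_mem_eq_sup (S.filter (· ≤ x))
      ⟨0, Finset.mem_filter.2 ⟨h0, Nat.zero_le x⟩⟩ id
    change (S.filter (· ≤ x)).sup id ∈ S
    rw [he]
    exact (Finset.mem_filter.1 hk).1
  · exact Finset.sup_mono fun z hz => by
      rw [Finset.mem_filter] at hz ⊢
      exact ⟨hz.1, hz.2.trans hxy⟩
  · refine le_antisymm (Finset.sup_le fun z hz => (Finset.mem_filter.1 hz).2) ?_
    exact Finset.le_sup (f := id) (Finset.mem_filter.2 ⟨hk, le_rfl⟩)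

/-- The empirical distribution function of the points `x ↦ (σ l x)_l`. -/
noncomputable def permCopula {M L : ℕ} (σ : Fin L → Equiv.Perm (Fin M)) (i : Fin L → ℕ) : ℝ :=
  ((Finset.univ.filter fun x => ∀ l, (σ l x : ℕ) < i l).card : ℝ) / M

open Finset in
theorem card_perm_lt {M : ℕ} (σ : Equiv.Perm (Fin M)) {k : ℕ} (hk : k ≤ M) :
    (univ.filter fun x => (σ x : ℕ) < k).card = k := by
  rw [card_filter, Equiv.sum_comp σ (fun x => if (x : ℕ) < k then 1 else 0),
    Fin.sum_univ_eq_sum_range (fun x => if x < k then 1 else 0), ← card_filter]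
  have : (range M).filter (· < k) = range k := by
    ext x
    simp only [mem_filter, mem_range]
    omega
  rw [this, card_range]

open Finset in
theorem permCopula_margin {M L : ℕ} (σ : Fin L → Equiv.Perm (Fin M)) (l : Fin L) {k : ℕ}
    (hk : k ≤ M) : permCopula σ (fun l' => if l' = l then k else M) = (k : ℝ) / M := by
  have h : (univ.filter fun x => ∀ l', (σ l' x : ℕ) < if l' = l then k else M) =
      univ.filter fun x => (σ l x : ℕ) < k := by
    refine filter_congr fun x _ => ⟨fun h => by simpa using h l, fun h l' => ?_⟩
    split_ifs with hl
    · exact hl ▸ h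
    · exact (σ l' x).2
  rw [permCopula, h, card_perm_lt _ hk]

open Finset in
theorem isDiscreteCopula_permCopula {M L : ℕ} (σ : Fin L → Equiv.Perm (Fin M)) :
    IsDiscreteCopula M L (permCopula σ) := by
  refine ⟨fun i _ => ⟨by unfold permCopula; positivity, ?_⟩, fun i _ ⟨l, hl⟩ => ?_,
    fun l k hk => permCopula_margin σ l hk, fun i _ => ?_⟩
  · refine div_le_one_of_le₀ ?_ (Nat.cast_nonneg M)
    exact_mod_cast (card_le_univ _).trans_eq (Fintype.card_fin M)
  · rw [permCopula, filter_false_of_mem, card_empty, Nat.cast_zero, zero_div]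
    intro x _ h
    simpa [hl] using h l
  · have h : ∀ y : Fin L → ℕ, permCopula σ y =
        (∑ x, ∏ l, if (σ l x : ℕ) < y l then (1 : ℝ) else 0) / M := by
      intro y
      rw [permCopula, card_filter]
      push_cast
      congr 1
      refine sum_congr rfl fun x _ => ?_
      rw [prod_boole]
      simp
    simp_rw [h, mul_div_assoc', ← sum_div, mul_sum]
    rw [sum_comm]
    refine div_nonneg (sum_nonneg fun x _ => ?_) (Nat.cast_nonneg M)
    rw [sum_alternating_prod (fun l y => if (σ l x : ℕ) < y then (1 : ℝ) else 0)]
    refine prod_nonneg fun l _ => ?_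
    split_ifs <;> first | omega | norm_num

open Finset in
theorem isIrreducibleOn_permCopula {M L : ℕ} (hL : 1 ≤ L) (σ : Fin L → Equiv.Perm (Fin M)) :
    IsIrreducibleOn M L (permCopula σ) := by
  ext y
  constructor
  · rintro ⟨i, _, rfl⟩
    exact ⟨_, (card_le_univ _).trans_eq (Fintype.card_fin M), rfl⟩
  · rintro ⟨k, hk, rfl⟩
    refine ⟨fun l' => if l' = ⟨0, hL⟩ then k else M, fun l => ?_, permCopula_margin σ _ hk⟩
    dsimp only
    split_ifs <;> omega

open Finset in
/-- The masses of an irreducible subcopula, as multiplicities of unit cells. -/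
theorem exists_cell_multiplicities {M L : ℕ} (hM : 1 ≤ M) {J : Fin L → Finset ℕ}
    {Dst : (Fin L → ℕ) → ℝ} (hsub : IsDiscreteSubcopula M L J Dst)
    (hirr : SubcopulaIrreducible M L J Dst) :
    ∃ m : (Fin L → ℕ) → ℕ, ∀ i : Fin L → ℕ, (∀ l, i l ∈ J l) →
      ((∑ j ∈ Fintype.piFinset (fun l => range (i l)), m j : ℕ) : ℝ) = M * Dst i := by
  obtain ⟨hJ, -, hground, -, hinc⟩ := hsub
  choose r hrJ hrmono hrid using fun l => exists_monotone_retraction (J l) (hJ l).2.1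
  have hM0 : (M : ℝ) ≠ 0 := by positivity
  have hmass : ∀ j : Fin L → ℕ, ∃ n : ℕ, (n : ℝ) =
      M * ∑ ε : Fin L → Bool, (-1 : ℝ) ^ (univ.filter fun l => ε l = true).card *
        Dst (fun l => r l (if ε l then j l else j l + 1)) := by
    intro j
    have hnonneg : 0 ≤ ∑ ε : Fin L → Bool,
        (-1 : ℝ) ^ (univ.filter fun l => ε l = true).card *
        Dst (fun l => r l (if ε l then j l else j l + 1)) := by
      simp_rw [apply_ite (r _)]
      exact hinc _ _ (fun l => hrJ l _) (fun l => hrJ l _)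
        fun l => hrmono l (Nat.le_succ _)
    choose n hn using fun ε : Fin L → Bool =>
      hirr (fun l => r l (if ε l then j l else j l + 1)) fun l => hrJ l _
    have hint : M * ∑ ε : Fin L → Bool,
        (-1 : ℝ) ^ (univ.filter fun l => ε l = true).card *
        Dst (fun l => r l (if ε l then j l else j l + 1)) =
        ((∑ ε : Fin L → Bool,
          (-1) ^ (univ.filter fun l => ε l = true).card * (n ε : ℤ) : ℤ) : ℝ) := by
      push_cast
      rw [mul_sum]
      refine sum_congr rfl fun ε _ => ?_
      rw [(hn ε).2]
      field_simp
    have hpos := mul_nonneg (Nat.cast_nonneg (α := ℝ) M) hnonneg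
    rw [hint] at hpos ⊢
    obtain ⟨k, hk⟩ := Int.eq_ofNat_of_zero_le (Int.cast_nonneg_iff.1 hpos)
    exact ⟨k, by rw [hk]; simp⟩
  choose m hm using hmass
  refine ⟨m, fun i hi => ?_⟩
  push_cast
  simp_rw [hm, ← mul_sum]
  rw [sum_box_differences (fun y => Dst fun l => r l (y l))]
  · simp_rw [fun l => hrid l _ (hi l)]
  · rintro y ⟨l, hl⟩
    exact hground _ (fun l => hrJ l _) ⟨l, by rw [hl, hrid l 0 (hJ l).2.1]⟩

/-- Extension lemma: every irreducible discrete subcopula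
extends to an irreducible discrete copula on `I_M^L`. -/
theorem subcopula_extension (M L : ℕ) (hM : 1 ≤ M) (hL : 1 ≤ L)
    (J : Fin L → Finset ℕ) (Dst : (Fin L → ℕ) → ℝ)
    (hsub : IsDiscreteSubcopula M L J Dst)
    (hirr : SubcopulaIrreducible M L J Dst) :
    ∃ D : (Fin L → ℕ) → ℝ, IsDiscreteCopula M L D ∧ IsIrreducibleOn M L D ∧
      ∀ i : Fin L → ℕ, (∀ l, i l ∈ J l) → D i = Dst i := by
  obtain ⟨m, hm⟩ := exists_cell_multiplicities hM hsub hirr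
  obtain ⟨hJ, -, -, hmargin, -⟩ := hsub
  have hM0 : (M : ℝ) ≠ 0 := by positivity
  have hJle : ∀ l, ∀ k ∈ J l, k ≤ M := fun l k hk =>
    Nat.lt_succ_iff.1 (Finset.mem_range.1 ((hJ l).1 hk))
  have hmem : ∀ l, ∀ k ∈ J l, ∀ l', (if l' = l then k else M) ∈ J l' := by
    intro l k hk l'
    split_ifs with h
    · exact h ▸ hk
    · exact (hJ l').2.2
  have htotal : ∑ j ∈ Fintype.piFinset (fun _ : Fin L => Finset.range M), m j = M := by
    have h := hm (fun _ => M) fun l => (hJ l).2.2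
    have h1 := hmargin ⟨0, hL⟩ M (hJ _).2.2
    simp only [ite_self] at h1
    rw [h1, mul_div_cancel₀ _ hM0] at h
    exact_mod_cast h
  obtain ⟨Q, hQ⟩ := exists_family_of_multiplicities _ m M htotal
  have hcount : ∀ i : Fin L → ℕ, (∀ l, i l ∈ J l) →
      ((Finset.univ.filter fun x => ∀ l, Q x l < i l).card : ℝ) = M * Dst i := by
    intro i hi
    rw [hQ (fun y => ∀ l, y l < i l), ← hm i hi]
    congr 2
    ext y
    simp only [Finset.mem_filter, Fintype.mem_piFinset, Finset.mem_range]
    exact ⟨fun h => h.2, fun h => ⟨fun l => (h l).trans_le (hJle l _ (hi l)), h⟩⟩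
  have hQlt : ∀ x l, Q x l < M := by
    intro x
    have h := hcount (fun _ => M) fun l => (hJ l).2.2
    have h1 := hmargin ⟨0, hL⟩ M (hJ _).2.2
    simp only [ite_self] at h1
    rw [h1, mul_div_cancel₀ _ hM0] at h
    have h2 : (Finset.univ.filter fun x => ∀ l, Q x l < M).card = Fintype.card (Fin M) := by
      rw [Fintype.card_fin]
      exact_mod_cast h
    have h3 := (Finset.card_eq_iff_eq_univ _).1 h2 ▸ Finset.mem_univ x
    exact (Finset.mem_filter.1 h3).2
  choose σ hσ using fun l => exists_ranking fun x => Q x l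
  have hrank : ∀ l, ∀ k ∈ J l, ∀ x, (σ l x : ℕ) < k ↔ Q x l < k := by
    intro l k hk
    refine hσ l k ?_
    have h := hcount _ (hmem l k hk)
    rw [hmargin l k hk, mul_div_cancel₀ _ hM0] at h
    rw [← Nat.cast_inj (R := ℝ), ← h]
    congr 2
    refine Finset.filter_congr fun x _ => ⟨fun h l' => ?_, fun h => by simpa using h l⟩
    split_ifs with hl
    · exact hl ▸ h
    · exact hQlt x l'
  refine ⟨permCopula σ, isDiscreteCopula_permCopula σ, isIrreducibleOn_permCopula hL σ,
    fun i hi => ?_⟩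
  have h : (Finset.univ.filter fun x => ∀ l, (σ l x : ℕ) < i l) =
      Finset.univ.filter fun x => ∀ l, Q x l < i l :=
    Finset.filter_congr fun x _ => forall_congr' fun l => hrank l _ (hi l) x
  rw [permCopula, h, hcount i hi, mul_div_cancel_left₀ _ hM0]
end

section
/- (Sklar's theorem in the multivariate discrete case, part 2, existence) Let H be a joint distribution function on ℝ̄^L with marginal distribution functions F_1,...,F_L and Ran(H) ⊆ I_M. Then there exists an irreducible discrete copula D on I_M^L such that H(x_1,...,x_L) = D(F_1(x_1),...,F_L(x_L)) for all (x_1,...,x_L) ∈ ℝ̄^L. -/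
open MeasureTheory

/-- `F : ℝ̄ → [0,1]` is a (one-dimensional) distribution function:
nondecreasing, right-continuous on `ℝ`, `F(−∞) = 0`, `F(∞) = 1`. -/
def IsDistributionFunction (F : EReal → ℝ) : Prop :=
  Monotone F ∧
  (∀ t : ℝ, ContinuousWithinAt (fun s : ℝ => F (s : EReal)) (Set.Ici t) t) ∧
  F ⊥ = 0 ∧ F ⊤ = 1

/-- If the joint distribution function of a probability measure on `ℝ^ι` takes values in
`{0, 1/M, …, 1}`, then so does the measure of every measurable set. -/
lemma mul_measureReal_mem_range_natCast {ι : Type*} [Finite ι] (M : ℕ)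
    (μ : Measure (ι → ℝ)) [IsProbabilityMeasure μ]
    (h : ∀ x : ι → ℝ, (M : ℝ) * μ.real (Set.Iic x) ∈ Set.range (Nat.cast : ℕ → ℝ))
    {A : Set (ι → ℝ)} (hA : MeasurableSet A) :
    (M : ℝ) * μ.real A ∈ Set.range (Nat.cast : ℕ → ℝ) := by
  have hgen : (MeasurableSpace.pi : MeasurableSpace (ι → ℝ)) = MeasurableSpace.generateFrom
      (Set.univ.pi '' Set.univ.pi fun _ : ι => Set.range (Set.Iic : ℝ → Set ℝ)) := by
    refine (generateFrom_eq_pi (fun _ => ?_) (fun _ => ?_)).symm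
    · rw [← borel_eq_generateFrom_Iic]
      exact (BorelSpace.measurable_eq (α := ℝ)).symm
    · refine ⟨fun n => Set.Iic (n : ℝ), fun n => ⟨_, rfl⟩, ?_⟩
      exact Set.eq_univ_of_forall fun x =>
        Set.mem_iUnion.2 ((exists_nat_ge x).imp fun n hn => hn)
  have hpi : IsPiSystem
      (Set.univ.pi '' Set.univ.pi fun _ : ι => Set.range (Set.Iic : ℝ → Set ℝ)) := by
    refine IsPiSystem.pi fun _ => ?_
    simpa using isPiSystem_image_Iic (Set.univ : Set ℝ)
  induction A, hA using MeasurableSpace.induction_on_inter hgen hpi with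
  | empty => exact ⟨0, by simp⟩
  | basic t ht =>
    obtain ⟨s, hs, rfl⟩ := ht
    choose x hx using fun l => hs l (Set.mem_univ l)
    have : Set.univ.pi s = Set.Iic x := by
      rw [← Set.pi_univ_Iic]
      exact congrArg _ (funext fun l => (hx l).symm)
    rw [this]
    exact h x
  | compl t htm ih =>
    obtain ⟨k, hk⟩ := ih
    have hkM : k ≤ M := by
      have : (k : ℝ) ≤ M := hk ▸ mul_le_of_le_one_right (Nat.cast_nonneg M) measureReal_le_one
      exact_mod_cast this
    refine ⟨M - k, ?_⟩
    rw [probReal_compl_eq_one_sub htm, Nat.cast_sub hkM, hk]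
    ring
  | iUnion f hd hfm ih =>
    choose k hk using ih
    have hsum : HasSum (fun i => μ.real (f i)) (μ.real (⋃ i, f i)) := by
      have hfin : ∑' i, μ (f i) ≠ ⊤ := by
        rw [← measure_iUnion hd hfm]
        exact measure_ne_top _ _
      rw [measureReal_def, measure_iUnion hd hfm, ENNReal.tsum_toReal_eq fun i => measure_ne_top _ _]
      exact (ENNReal.summable_toReal hfin).hasSum
    refine Nat.isClosedEmbedding_coe_real.isClosed_range.mem_of_tendsto
      (hsum.mul_left (M : ℝ)) (Filter.Eventually.of_forall fun s => ⟨∑ i ∈ s, k i, ?_⟩)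
    push_cast
    exact Finset.sum_congr rfl fun i _ => hk i

/-- A family of multiplicities with total `M` is realised by `M` points. -/
lemma exists_fin_card_fiber_eq {V : Type*} [Fintype V] [DecidableEq V] {M : ℕ} (n : V → ℕ)
    (hn : ∑ w, n w = M) :
    ∃ v : Fin M → V, ∀ w, (Finset.univ.filter fun j => v j = w).card = n w := by
  have e : Fin M ≃ Σ w, Fin (n w) := Fintype.equivOfCardEq (by simp [hn])
  refine ⟨fun j => (e j).1, fun w => ?_⟩
  rw [← Fintype.card_subtype]
  have e' : {j // (e j).1 = w} ≃ Fin (n w) :=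
    (e.subtypeEquiv (q := fun s => s.1 = w) fun _ => Iff.rfl).trans (Equiv.sigmaSubtype w)
  simpa using Fintype.card_congr e'

/-- The law of a finitely valued random variable whose probabilities are multiples of `1/M` is
the empirical law of `M` points. -/
lemma exists_empirical_law {Ω V : Type*} [MeasurableSpace Ω] (μ : Measure Ω)
    [IsProbabilityMeasure μ] {M : ℕ}
    (hμ : ∀ A : Set Ω, MeasurableSet A →
      (M : ℝ) * μ.real A ∈ Set.range (Nat.cast : ℕ → ℝ))
    [Fintype V] [MeasurableSpace V] [MeasurableSingletonClass V] {R : Ω → V}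
    (hR : Measurable R) :
    ∃ v : Fin M → V, ∀ (P : V → Prop) [DecidablePred P],
      (M : ℝ) * μ.real {a | P (R a)} = (Finset.univ.filter fun j => P (v j)).card := by
  classical
  choose n hn using fun w : V => hμ (R ⁻¹' {w}) (hR (measurableSet_singleton w))
  have hsum (B : Finset V) : (M : ℝ) * μ.real (R ⁻¹' (B : Set V)) = ∑ w ∈ B, (n w : ℝ) := by
    rw [← sum_measureReal_preimage_singleton B fun y _ => hR (measurableSet_singleton y),
      Finset.mul_sum]
    exact Finset.sum_congr rfl fun w _ => (hn w).symm
  have htot : ∑ w, n w = M := by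
    have := hsum Finset.univ
    simp only [Finset.coe_univ, Set.preimage_univ, probReal_univ, mul_one] at this
    exact_mod_cast this.symm
  obtain ⟨v, hv⟩ := exists_fin_card_fiber_eq n htot
  refine ⟨v, fun P _ => ?_⟩
  have hP : {a | P (R a)} = R ⁻¹' ((Finset.univ.filter P : Finset V) : Set V) := by
    ext; simp
  rw [hP, hsum, Finset.card_eq_sum_card_fiberwise (f := v) (t := Finset.univ.filter P)
    (fun j hj => by simpa using hj)]
  push_cast
  refine Finset.sum_congr rfl fun w hw => ?_
  rw [← hv w, Finset.filter_filter]
  congr 2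
  ext j
  simp only [Finset.mem_filter, Finset.mem_univ, true_and] at hw ⊢
  exact ⟨fun h => ⟨h ▸ hw, h⟩, fun h => h.2⟩

/-- The points of an `M`-point family can be ranked so that each sublevel set of cardinality `c`
consists of the points of rank less than `c`. -/
lemma exists_rank_perm {M : ℕ} {α : Type*} [LinearOrder α] (f : Fin M → α) :
    ∃ ρ : Equiv.Perm (Fin M), ∀ (j : Fin M) (a : α),
      ((ρ j : ℕ) < (Finset.univ.filter fun i => f i ≤ a).card ↔ f j ≤ a) := by
  refine ⟨(Tuple.sort f).symm, fun j a => ?_⟩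
  have h := Tuple.lt_card_le_iff_apply_le_of_monotone (j := (Tuple.sort f).symm j) (a := a)
    (Tuple.monotone_sort f)
  have hcard : (Finset.univ.filter fun i => (f ∘ Tuple.sort f) i ≤ a).card =
      (Finset.univ.filter fun i => f i ≤ a).card := by
    simp only [← Fintype.card_subtype]
    exact Fintype.card_congr ((Tuple.sort f).subtypeEquiv fun _ => Iff.rfl)
  rw [hcard] at h
  simpa using h

/-- The empirical discrete copula of `M` points with ranks `ρ l j`. -/
noncomputable def empiricalCopula (M L : ℕ) (ρ : Fin L → Equiv.Perm (Fin M))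
    (i : Fin L → ℕ) : ℝ :=
  ((Finset.univ.filter fun j : Fin M => ∀ l, (ρ l j : ℕ) < i l).card : ℝ) / M

lemma card_filter_perm_lt {M k : ℕ} (hk : k ≤ M) (ρ : Equiv.Perm (Fin M)) :
    (Finset.univ.filter fun j : Fin M => (ρ j : ℕ) < k).card = k := by
  rw [← Fintype.card_subtype,
    Fintype.card_congr (ρ.subtypeEquiv (q := fun j : Fin M => (j : ℕ) < k) fun _ => Iff.rfl),
    Fintype.card_subtype, Fin.card_filter_val_lt, min_eq_right hk]

lemma empiricalCopula_margin {M L : ℕ} (ρ : Fin L → Equiv.Perm (Fin M)) (l : Fin L) {k : ℕ}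
    (hk : k ≤ M) :
    empiricalCopula M L ρ (fun l' => if l' = l then k else M) = (k : ℝ) / M := by
  unfold empiricalCopula
  have : (Finset.univ.filter fun j : Fin M => ∀ l', (ρ l' j : ℕ) < if l' = l then k else M) =
      Finset.univ.filter fun j : Fin M => (ρ l j : ℕ) < k := by
    refine Finset.filter_congr fun j _ => ⟨fun h => by simpa using h l, fun h l' => ?_⟩
    split_ifs with hl
    · exact hl ▸ h
    · exact (ρ l' j).isLt
  rw [this, card_filter_perm_lt hk]

/-- The alternating sum over the corners of a unit cell of an indicator of an orthant is
nonnegative. -/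
lemma alternating_sum_orthant_nonneg {L : ℕ} (r i : Fin L → ℕ) :
    0 ≤ ∑ ε : Fin L → Bool, (-1 : ℝ) ^ (Finset.univ.filter fun l => ε l = true).card *
      (if ∀ l, r l < (if ε l then i l - 1 else i l) then 1 else 0) := by
  have hprod : ∏ l, ∑ b : Bool, (if b then (-1 : ℝ) else 1) *
      (if r l < (if b then i l - 1 else i l) then 1 else 0) =
      ∑ ε : Fin L → Bool, (-1 : ℝ) ^ (Finset.univ.filter fun l => ε l = true).card *
        (if ∀ l, r l < (if ε l then i l - 1 else i l) then 1 else 0) := by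
    rw [Finset.prod_univ_sum, Fintype.piFinset_univ]
    refine Finset.sum_congr rfl fun ε _ => ?_
    rw [Finset.prod_mul_distrib, Finset.prod_ite, Fintype.prod_boole]
    simp
  rw [← hprod]
  refine Finset.prod_nonneg fun l _ => ?_
  rw [Fintype.sum_bool]
  split_ifs <;> first | omega | simp_all

lemma isDiscreteCopula_empiricalCopula {M L : ℕ} (hM : 1 ≤ M)
    (ρ : Fin L → Equiv.Perm (Fin M)) : IsDiscreteCopula M L (empiricalCopula M L ρ) := by
  have hM0 : (0 : ℝ) < M := by exact_mod_cast hM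
  refine ⟨fun i _ => ⟨by unfold empiricalCopula; positivity, ?_⟩, fun i _ ⟨l, hl⟩ => ?_,
    fun l k hk => empiricalCopula_margin ρ l hk, fun i _ => ?_⟩
  · rw [empiricalCopula, div_le_one hM0]
    exact_mod_cast (Finset.card_filter_le _ _).trans_eq (Finset.card_fin M)
  · rw [empiricalCopula, Finset.filter_false_of_mem, Finset.card_empty]
    · simp
    · exact fun j _ h => by simpa [hl] using h l
  · have : ∑ ε : Fin L → Bool, (-1 : ℝ) ^ (Finset.univ.filter fun l => ε l = true).card *
          empiricalCopula M L ρ (fun l => if ε l then i l - 1 else i l) =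
        (∑ j : Fin M, ∑ ε : Fin L → Bool,
          (-1 : ℝ) ^ (Finset.univ.filter fun l => ε l = true).card *
          (if ∀ l, (ρ l j : ℕ) < (if ε l then i l - 1 else i l) then 1 else 0)) / M := by
      rw [Finset.sum_comm, Finset.sum_div]
      refine Finset.sum_congr rfl fun ε _ => ?_
      rw [empiricalCopula, ← Finset.mul_sum, Finset.sum_boole, mul_div_assoc]
    rw [this]
    exact div_nonneg (Finset.sum_nonneg fun j _ => alternating_sum_orthant_nonneg _ _) hM0.le

lemma isIrreducibleOn_empiricalCopula {M L : ℕ} (hL : 1 ≤ L)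
    (ρ : Fin L → Equiv.Perm (Fin M)) : IsIrreducibleOn M L (empiricalCopula M L ρ) := by
  ext y
  constructor
  · rintro ⟨i, _, rfl⟩
    exact ⟨_, (Finset.card_filter_le _ _).trans_eq (Finset.card_fin M), rfl⟩
  · rintro ⟨k, hk, rfl⟩
    refine ⟨fun l => if l = ⟨0, hL⟩ then k else M, fun l => ?_, empiricalCopula_margin ρ _ hk⟩
    dsimp only
    split_ifs
    · exact hk
    · exact le_rfl

/-- Almost surely, a coordinate does not lie strictly to the right of `x` in the set where its
distribution function has not yet exceeded its value at `x`. -/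
lemma measure_lt_and_margin_le_eq_zero {ι : Type*} [Finite ι] (μ : Measure (ι → ℝ))
    [IsProbabilityMeasure μ] (l : ι) (G : EReal → ℝ)
    (hG : ∀ t : EReal, μ.real {p : ι → ℝ | (p l : EReal) ≤ t} = G t) (x : EReal) :
    μ {p : ι → ℝ | x < p l ∧ G (p l) ≤ G x} = 0 := by
  have hmeas : Measurable fun p : ι → ℝ => (p l : EReal) := by fun_prop
  have hstrip (t : ℝ) (hxt : x < t) (ht : G t ≤ G x) :
      μ {p : ι → ℝ | x < p l ∧ p l ≤ t} = 0 := by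
    have hdiff : {p : ι → ℝ | x < p l ∧ p l ≤ t} =
        {p : ι → ℝ | (p l : EReal) ≤ t} \ {p : ι → ℝ | (p l : EReal) ≤ x} := by
      ext p
      simp [and_comm]
    have hsub : {p : ι → ℝ | (p l : EReal) ≤ x} ⊆ {p : ι → ℝ | (p l : EReal) ≤ t} :=
      fun p hp => le_trans hp hxt.le
    rw [← measureReal_eq_zero_iff, hdiff,
      measureReal_sdiff hsub (measurableSet_le hmeas measurable_const), hG, hG]
    refine le_antisymm (sub_nonpos.2 ht) ?_
    rw [← hG, ← hG, sub_nonneg]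
    exact measureReal_mono hsub
  refine measure_null_of_locally_null _ fun p hp => ?_
  by_cases hq : ∃ q : ι → ℝ, (x < q l ∧ G (q l) ≤ G x) ∧ p l < q l
  · obtain ⟨q, ⟨hxq, hGq⟩, hpq⟩ := hq
    refine ⟨_, ?_, hstrip (q l) hxq hGq⟩
    have hopen : {p' : ι → ℝ | p' l < q l} ∈ nhds p :=
      (isOpen_lt (continuous_apply l) continuous_const).mem_nhds hpq
    filter_upwards [self_mem_nhdsWithin, mem_nhdsWithin_of_mem_nhds hopen] with p' h1 h2
    exact ⟨h1.1, le_of_lt h2⟩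
  · refine ⟨_, ?_, hstrip (p l) hp.1 hp.2⟩
    filter_upwards [self_mem_nhdsWithin] with p' h1
    exact ⟨h1.1, not_lt.1 fun h => hq ⟨p', h1, h⟩⟩

/-- discrete multivariate Sklar, part 2, existence: if `H`
(the cdf of a probability measure `μ` on `ℝ^L`) is a joint distribution
function with marginal distribution functions `F₁,…,F_L` and range contained
in `I_M`, then there is an irreducible discrete copula `D` on `I_M^L` with
`H(x) = D(F₁(x₁),…,F_L(x_L))` for all `x ∈ ℝ̄^L`. -/
theorem discrete_sklar_part2_existence (M L : ℕ) (hM : 1 ≤ M) (hL : 1 ≤ L)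
    (μ : Measure (Fin L → ℝ)) (hμ : IsProbabilityMeasure μ)
    (F : Fin L → EReal → ℝ)
    (hF : ∀ l, IsDistributionFunction (F l))
    (hmarg : ∀ (l : Fin L) (t : EReal),
      (μ {p : Fin L → ℝ | (p l : EReal) ≤ t}).toReal = F l t)
    (hran : ∀ x : Fin L → EReal, ∃ k : ℕ, k ≤ M ∧
      (μ {p : Fin L → ℝ | ∀ l, (p l : EReal) ≤ x l}).toReal = (k : ℝ) / M) :
    ∃ D : (Fin L → ℕ) → ℝ, IsDiscreteCopula M L D ∧ IsIrreducibleOn M L D ∧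
      ∀ (x : Fin L → EReal) (k : Fin L → ℕ),
        (∀ l, k l ≤ M ∧ F l (x l) = (k l : ℝ) / M) →
        (μ {p : Fin L → ℝ | ∀ l, (p l : EReal) ≤ x l}).toReal = D k := by
  have hM0 : (0 : ℝ) < M := by exact_mod_cast hM
  have hvalue (l : Fin L) (t : EReal) : ∃ k : ℕ, k ≤ M ∧ F l t = (k : ℝ) / M := by
    obtain ⟨k, hk, h⟩ := hran fun l' => if l' = l then t else ⊤
    refine ⟨k, hk, ?_⟩
    rw [← hmarg, ← h]
    congr 2
    ext p
    refine ⟨fun hp l' => ?_, fun hp => by simpa using hp l⟩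
    split_ifs with hl
    · exact hl ▸ hp
    · exact le_top
  choose r hrM hr using hvalue
  have hle (l : Fin L) (s t : EReal) : r l s ≤ r l t ↔ F l s ≤ F l t := by
    rw [hr, hr, div_le_div_iff_of_pos_right hM0, Nat.cast_le]
  have hint (A : Set (Fin L → ℝ)) (hA : MeasurableSet A) :
      (M : ℝ) * μ.real A ∈ Set.range (Nat.cast : ℕ → ℝ) := by
    refine mul_measureReal_mem_range_natCast M μ (fun x => ?_) hA
    obtain ⟨k, -, h⟩ := hran fun l => x l
    refine ⟨k, ?_⟩
    have hx : Set.Iic x = {p : Fin L → ℝ | ∀ l, (p l : EReal) ≤ x l} := by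
      ext p
      simp [Pi.le_def]
    rw [measureReal_def, hx, h]
    field_simp
  let R : (Fin L → ℝ) → Fin L → Fin (M + 1) := fun p l => ⟨r l (p l), Nat.lt_succ_of_le (hrM l _)⟩
  have hR : Measurable R := by
    refine measurable_pi_lambda _ fun l => ?_
    have hmono : Monotone fun t : ℝ => (⟨r l t, Nat.lt_succ_of_le (hrM l _)⟩ : Fin (M + 1)) :=
      fun s t hst => (hle l s t).2 ((hF l).1 (EReal.coe_le_coe_iff.2 hst))
    exact hmono.measurable.comp (measurable_pi_apply l)
  obtain ⟨v, hv⟩ := exists_empirical_law μ hint hR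
  choose ρ hρ using fun l => exists_rank_perm fun j => v j l
  refine ⟨empiricalCopula M L ρ, isDiscreteCopula_empiricalCopula hM ρ,
    isIrreducibleOn_empiricalCopula hL ρ, fun x k hk => ?_⟩
  have hkr (l : Fin L) : r l (x l) = k l := by
    have h := (hk l).2
    rw [hr, div_left_inj' hM0.ne'] at h
    exact_mod_cast h
  have hae (l : Fin L) : ∀ᵐ p ∂μ, (r l (p l) ≤ r l (x l) ↔ (p l : EReal) ≤ x l) := by
    have h0 := measure_lt_and_margin_le_eq_zero μ l (F l) (hmarg l) (x l)
    filter_upwards [measure_eq_zero_iff_ae_notMem.1 h0] with p hp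
    rw [hle]
    exact ⟨fun h => not_lt.1 fun hlt => hp ⟨hlt, h⟩, fun h => (hF l).1 h⟩
  let c : Fin L → Fin (M + 1) := fun l => ⟨r l (x l), Nat.lt_succ_of_le (hrM l _)⟩
  have hcard (l : Fin L) : (Finset.univ.filter fun j => v j l ≤ c l).card = k l := by
    have h := hv fun w => w l ≤ c l
    have hset : μ.real {p | R p l ≤ c l} = F l (x l) := by
      rw [← hmarg]
      refine measureReal_congr ?_
      filter_upwards [hae l] with p hp
      exact propext hp
    rw [hset, (hk l).2, mul_div_cancel₀ _ hM0.ne'] at h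
    exact_mod_cast h.symm
  have hjoint : (μ {p : Fin L → ℝ | ∀ l, (p l : EReal) ≤ x l}).toReal =
      μ.real {p | ∀ l, R p l ≤ c l} := by
    refine measureReal_congr ?_
    filter_upwards [ae_all_iff.2 hae] with p hp
    exact propext (forall_congr' fun l => (hp l).symm)
  rw [hjoint, empiricalCopula, eq_div_iff hM0.ne', mul_comm, hv fun w => ∀ l, w l ≤ c l]
  congr 2
  refine Finset.filter_congr fun j _ => forall_congr' fun l => ?_
  rw [← hcard l, hρ l j (c l)]
end

section
/- Let H be a joint distribution function on ℝ̄^L with marginal distribution functions F_1,...,F_L and Ran(H) ⊆ I_M. Set J_M^{(ℓ)} = {i_ℓ/M ∈ I_M : i_ℓ/M ∈ Ran(F_ℓ)} for each ℓ, so {0,1} ⊆ J_M^{(ℓ)} ⊆ I_M. Then the function D* : J_M^{(1)} × ⋯ × J_M^{(L)} → I_M given by D*(i_1/M,...,i_L/M) = H(x_1,...,x_L), where for each ℓ the point x_ℓ ∈ ℝ̄ is any point with F_ℓ(x_ℓ) = i_ℓ/M, is well defined (independent of the choice of the x_ℓ) and is an irreducible discrete subcopula. -/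
open MeasureTheory

theorem measurableSet_eval_coe_le {L : ℕ} (l : Fin L) (t : EReal) :
    MeasurableSet {p : Fin L → ℝ | (p l : EReal) ≤ t} :=
  measurableSet_le (measurable_coe_real_ereal.comp (measurable_pi_apply l)) measurable_const

/-- Half-spaces in the same coordinate with equal finite measure agree almost everywhere. -/
theorem eval_coe_le_ae_eq {L : ℕ} (μ : Measure (Fin L → ℝ)) [IsFiniteMeasure μ] (l : Fin L)
    {s t : EReal}
    (h : μ {p : Fin L → ℝ | (p l : EReal) ≤ s} = μ {p : Fin L → ℝ | (p l : EReal) ≤ t}) :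
    ({p : Fin L → ℝ | (p l : EReal) ≤ s} : Set (Fin L → ℝ)) =ᵐ[μ]
      {p : Fin L → ℝ | (p l : EReal) ≤ t} := by
  wlog hst : s ≤ t generalizing s t
  · exact (this h.symm (le_of_not_ge hst)).symm
  · exact ae_eq_of_subset_of_measure_ge (fun p hp => le_trans hp hst) h.ge
      (measurableSet_eval_coe_le l s).nullMeasurableSet (measure_ne_top _ _)

theorem measure_orthant_congr {L : ℕ} (μ : Measure (Fin L → ℝ)) [IsFiniteMeasure μ]
    {x y : Fin L → EReal}
    (h : ∀ l, μ {p : Fin L → ℝ | (p l : EReal) ≤ x l} = μ {p : Fin L → ℝ | (p l : EReal) ≤ y l}) :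
    μ {p : Fin L → ℝ | ∀ l, (p l : EReal) ≤ x l} =
      μ {p : Fin L → ℝ | ∀ l, (p l : EReal) ≤ y l} := by
  simp only [Set.ofPred_forall]
  exact measure_congr (Filter.EventuallyEq.countable_iInter fun l => eval_coe_le_ae_eq μ l (h l))

/-- The measure of an orthant, as the integral of a product of indicators. -/
theorem toReal_measure_orthant {L : ℕ} (μ : Measure (Fin L → ℝ)) (x : Fin L → EReal) :
    (μ {p : Fin L → ℝ | ∀ l, (p l : EReal) ≤ x l}).toReal =
      ∫ p, ∏ l, {p : Fin L → ℝ | (p l : EReal) ≤ x l}.indicator (1 : (Fin L → ℝ) → ℝ) p ∂μ := by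
  have hm : MeasurableSet {p : Fin L → ℝ | ∀ l, (p l : EReal) ≤ x l} := by
    rw [Set.ofPred_forall]
    exact MeasurableSet.iInter fun l => measurableSet_eval_coe_le l (x l)
  rw [← Measure.real, ← integral_indicator_one hm]
  congr 1 with p
  simp only [Set.indicator_apply, Set.mem_ofPred_eq, Pi.one_apply, Finset.prod_boole,
    Finset.mem_univ, true_imp_iff]

/-- The distribution function of a finite measure is `L`-increasing. -/
theorem sum_orthant_box_nonneg {L : ℕ} (μ : Measure (Fin L → ℝ)) [IsFiniteMeasure μ]
    {x y : Fin L → EReal} (hxy : ∀ l, x l ≤ y l) :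
    0 ≤ ∑ ε : Fin L → Bool,
      (-1 : ℝ) ^ (Finset.univ.filter fun l => ε l = true).card *
        (μ {p : Fin L → ℝ | ∀ l, (p l : EReal) ≤ if ε l then x l else y l}).toReal := by
  have hint (z : Fin L → EReal) : Integrable (fun p : Fin L → ℝ =>
      ∏ l, {p : Fin L → ℝ | (p l : EReal) ≤ z l}.indicator (1 : (Fin L → ℝ) → ℝ) p) μ := by
    refine Integrable.of_bound (C := 1) (Measurable.aestronglyMeasurable ?_) ?_
    · exact Finset.measurable_fun_prod _ fun l _ =>
        measurable_one.indicator (measurableSet_eval_coe_le l (z l))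
    · refine Filter.Eventually.of_forall fun p => ?_
      rw [norm_prod]
      refine Finset.prod_le_one (fun _ _ => norm_nonneg _) fun l _ => ?_
      exact (norm_indicator_le_norm_self _ _).trans (by simp)
  simp only [toReal_measure_orthant, ← integral_const_mul]
  rw [← integral_finsetSum _ fun ε _ => (hint _).const_mul _]
  refine integral_nonneg fun p => ?_
  have key : ∏ l, ∑ e : Bool, (if e then (-1 : ℝ) else 1) *
        {p : Fin L → ℝ | (p l : EReal) ≤ if e then x l else y l}.indicator
          (1 : (Fin L → ℝ) → ℝ) p =
      ∑ ε : Fin L → Bool, (-1 : ℝ) ^ (Finset.univ.filter fun l => ε l = true).card *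
        ∏ l, {p : Fin L → ℝ | (p l : EReal) ≤ if ε l then x l else y l}.indicator
          (1 : (Fin L → ℝ) → ℝ) p := by
    rw [Finset.prod_univ_sum, Fintype.piFinset_univ]
    refine Finset.sum_congr rfl fun ε _ => ?_
    rw [Finset.prod_mul_distrib, Finset.prod_ite, Finset.prod_const, Finset.prod_const_one,
      mul_one]
  refine le_of_le_of_eq (Finset.prod_nonneg fun l _ => ?_) key
  have hsub : {p : Fin L → ℝ | (p l : EReal) ≤ x l} ⊆ {p : Fin L → ℝ | (p l : EReal) ≤ y l} :=
    fun q hq => le_trans hq (hxy l)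
  have := Set.indicator_le_indicator_of_subset hsub (f := (1 : (Fin L → ℝ) → ℝ))
    (fun _ => zero_le_one) p
  simp only [Fintype.sum_bool, if_true, Bool.false_eq_true, if_false]
  linarith

/-- given a joint distribution function `H` (the cdf of a
probability measure `μ` on `ℝ^L`) with marginals `F₁,…,F_L` and range
contained in `I_M`, setting `J^{(ℓ)} = I_M ∩ Ran(F_ℓ)`, the function
`D*(i₁/M,…,i_L/M) := H(x₁,…,x_L)`, where `F_ℓ(x_ℓ) = i_ℓ/M`, is well defined
(independent of the choice of the `x_ℓ`), the sets `J^{(ℓ)}` contain `0` and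
`1`, and `D*` is an irreducible discrete subcopula. -/
theorem discrete_sklar_subcopula_construction (M L : ℕ) (hM : 1 ≤ M) (hL : 1 ≤ L)
    (μ : Measure (Fin L → ℝ)) (hμ : IsProbabilityMeasure μ)
    (F : Fin L → EReal → ℝ)
    (hF : ∀ l, IsDistributionFunction (F l))
    (hmarg : ∀ (l : Fin L) (t : EReal),
      (μ {p : Fin L → ℝ | (p l : EReal) ≤ t}).toReal = F l t)
    (hran : ∀ x : Fin L → EReal, ∃ k : ℕ, k ≤ M ∧
      (μ {p : Fin L → ℝ | ∀ l, (p l : EReal) ≤ x l}).toReal = (k : ℝ) / M)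
    (J : Fin L → Finset ℕ)
    (hJ : ∀ (l : Fin L) (k : ℕ),
      k ∈ J l ↔ k ≤ M ∧ ∃ t : EReal, F l t = (k : ℝ) / M)
    (Dst : (Fin L → ℕ) → ℝ)
    (hDst : ∀ (i : Fin L → ℕ) (x : Fin L → EReal),
      (∀ l, i l ∈ J l) → (∀ l, F l (x l) = (i l : ℝ) / M) →
      Dst i = (μ {p : Fin L → ℝ | ∀ l, (p l : EReal) ≤ x l}).toReal) :
    -- well-definedness: H(x) depends only on (F₁(x₁),…,F_L(x_L))
    (∀ x y : Fin L → EReal, (∀ l, F l (x l) = F l (y l)) →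
      (μ {p : Fin L → ℝ | ∀ l, (p l : EReal) ≤ x l}).toReal =
        (μ {p : Fin L → ℝ | ∀ l, (p l : EReal) ≤ y l}).toReal) ∧
    -- {0,1} ⊆ J^{(ℓ)}
    (∀ l : Fin L, 0 ∈ J l ∧ M ∈ J l) ∧
    IsDiscreteSubcopula M L J Dst ∧
    SubcopulaIrreducible M L J Dst := by
  have hM0 : (0 : ℝ) < M := by exact_mod_cast hM
  have hJ0M (l : Fin L) : 0 ∈ J l ∧ M ∈ J l :=
    ⟨(hJ l 0).2 ⟨Nat.zero_le _, ⊥, by simp [(hF l).2.2.1]⟩,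
      (hJ l M).2 ⟨le_rfl, ⊤, by rw [(hF l).2.2.2, div_self hM0.ne']⟩⟩
  have hsel (i : Fin L → ℕ) (hi : ∀ l, i l ∈ J l) :
      ∃ x : Fin L → EReal, ∀ l, F l (x l) = (i l : ℝ) / M := by
    choose x hx using fun l => ((hJ l (i l)).1 (hi l)).2
    exact ⟨x, hx⟩
  refine ⟨fun x y h => ?_, hJ0M, ⟨fun l => ⟨fun k hk => ?_, hJ0M l⟩, fun i hi => ?_,
    fun i hi h0 => ?_, fun l k hk => ?_, fun a b ha hb hab => ?_⟩, fun i hi => ?_⟩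
  · refine congrArg _ (measure_orthant_congr μ fun l => ?_)
    rw [← ENNReal.toReal_eq_toReal_iff' (measure_ne_top _ _) (measure_ne_top _ _), hmarg, hmarg, h]
  · exact Finset.mem_range.2 (Nat.lt_succ_of_le ((hJ l k).1 hk).1)
  · obtain ⟨x, hx⟩ := hsel i hi
    rw [hDst i x hi hx]
    exact ⟨ENNReal.toReal_nonneg, measureReal_le_one⟩
  · obtain ⟨x, hx⟩ := hsel i hi
    obtain ⟨l, hl⟩ := h0
    rw [hDst i x hi hx]
    refine le_antisymm ?_ ENNReal.toReal_nonneg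
    calc (μ {p : Fin L → ℝ | ∀ l, (p l : EReal) ≤ x l}).toReal
        ≤ (μ {p : Fin L → ℝ | (p l : EReal) ≤ x l}).toReal :=
          ENNReal.toReal_mono (measure_ne_top _ _) (measure_mono fun p hp => hp l)
      _ = 0 := by rw [hmarg, hx, hl, Nat.cast_zero, zero_div]
  · obtain ⟨-, t, ht⟩ := (hJ l k).1 hk
    rw [hDst _ (fun l' => if l' = l then t else ⊤), ← ht, ← hmarg]
    · congr 2 with p
      refine ⟨fun h => by simpa using h l, fun h l' => ?_⟩
      by_cases hl : l' = l
      · subst hl; simpa using h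
      · simp [hl]
    · intro l'
      split_ifs with hl
      · exact hl ▸ hk
      · exact (hJ0M l').2
    · intro l'
      by_cases hl : l' = l
      · subst hl; simpa using ht
      · simp [hl, (hF l').2.2.2, hM0.ne']
  · obtain ⟨x, hx⟩ := hsel a ha
    obtain ⟨y, hy⟩ := hsel b hb
    have hmax (l : Fin L) : F l (max (x l) (y l)) = (b l : ℝ) / M := by
      rw [(hF l).1.map_max, hx, hy]
      exact max_eq_right (by have := hab l; gcongr)
    have hbox := sum_orthant_box_nonneg μ fun l => le_max_left (x l) (y l)
    refine hbox.trans_eq (Finset.sum_congr rfl fun ε _ => ?_)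
    rw [hDst _ (fun l => if ε l then x l else max (x l) (y l))]
    · intro l
      split_ifs
      exacts [ha l, hb l]
    · intro l
      split_ifs
      exacts [hx l, hmax l]
  · obtain ⟨x, hx⟩ := hsel i hi
    rw [hDst i x hi hx]
    exact hran x
end
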